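/- Let n ≥ 2, q ≥ 0 and p ∈ ℝ. Then the Liouville property holds for (p,q) in dimension n if and only if the weak Liouville property holds for (p,q) in dimension n; that is, every positive classical solution of Δu + |∇u|^q u^p = 0 on ℝ^n is constant if and only if every positive classical solution u on ℝ^n satisfying |∇u|/u ≤ 1 and |∇u|^q u^{p−1} ≤ 1 everywhere is constant. Equivalently, 𝒟_L(n) = 𝒟_WL(n). -/

import Mathlib

open scoped BigOperators

/-- The Euclidean Laplacian of `u : ℝⁿ → ℝ`, defined as the sum of the second
partial derivatives in the coordinate directions. -/
noncomputable def elaplacian {n : ℕ} (u : EuclideanSpace ℝ (Fin n) → ℝ)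
    (x : EuclideanSpace ℝ (Fin n)) : ℝ :=
  ∑ i : Fin n, fderiv ℝ (fun y => fderiv ℝ u y (EuclideanSpace.single i 1)) x
    (EuclideanSpace.single i 1)

open Real Set Filter Topology MeasureTheory
open scoped ContDiff

/-- The partial derivative of `u` in the `i`-th coordinate direction. -/
noncomputable def pd {n : ℕ} (i : Fin n) (u : EuclideanSpace ℝ (Fin n) → ℝ)
    (x : EuclideanSpace ℝ (Fin n)) : ℝ :=
  fderiv ℝ u x (EuclideanSpace.single i 1)

section Basics

variable {n : ℕ}

local notation "E" => EuclideanSpace ℝ (Fin n)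

lemma elaplacian_eq (u : E → ℝ) (x : E) : elaplacian u x = ∑ i, pd i (pd i u) x := rfl

lemma sum_single (y : E) : ∑ i, y i • (EuclideanSpace.single i (1 : ℝ) : E) = y := by
  ext j
  simp [Finset.sum_apply, Pi.single_apply]

lemma fderiv_apply_eq_sum (u : E → ℝ) (x y : E) :
    fderiv ℝ u x y = ∑ i, y i * pd i u x := by
  conv_lhs => rw [← sum_single y]
  simp [pd, map_sum]

lemma pd_congr {u v : E → ℝ} {x : E} (h : u =ᶠ[𝓝 x] v) (i : Fin n) : pd i u x = pd i v x := by
  simp [pd, h.fderiv_eq]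

lemma pd_eventuallyEq {u v : E → ℝ} {x : E} (h : u =ᶠ[𝓝 x] v) (i : Fin n) :
    pd i u =ᶠ[𝓝 x] pd i v := by
  filter_upwards [h.eventuallyEq_nhds] with y hy using pd_congr hy i

lemma elaplacian_congr {u v : E → ℝ} {x : E} (h : u =ᶠ[𝓝 x] v) :
    elaplacian u x = elaplacian v x := by
  simp only [elaplacian_eq]
  exact Finset.sum_congr rfl fun i _ => pd_congr (pd_eventuallyEq h i) i

lemma ContDiff.pd {u : E → ℝ} {k m : ℕ∞ω} (hu : ContDiff ℝ k u) (h : m + 1 ≤ k)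
    (i : Fin n) : ContDiff ℝ m (_root_.pd i u) :=
  (hu.fderiv_right h).clm_apply contDiff_const

lemma ContDiff.pd_one {u : E → ℝ} (hu : ContDiff ℝ 2 u) (i : Fin n) :
    ContDiff ℝ 1 (_root_.pd i u) :=
  hu.pd (by norm_num [one_add_one_eq_two]) i

lemma ContDiff.continuous_pd {u : E → ℝ} (hu : ContDiff ℝ 1 u) (i : Fin n) :
    Continuous (_root_.pd i u) :=
  (hu.pd (m := 0) (by norm_num) i).continuous

lemma ContDiff.continuous_elaplacian {u : E → ℝ} (hu : ContDiff ℝ 2 u) :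
    Continuous (elaplacian u) := by
  have : elaplacian u = fun x => ∑ i, _root_.pd i (_root_.pd i u) x := rfl
  rw [this]
  exact continuous_finsetSum _ fun i _ => (hu.pd_one i).continuous_pd i

lemma pd_comm {u : E → ℝ} {x : E} (hu : ContDiffAt ℝ 2 u x) (i j : Fin n) :
    pd i (pd j u) x = pd j (pd i u) x := by
  have hd : DifferentiableAt ℝ (fderiv ℝ u) x :=
    (hu.fderiv_right (m := 1) (by norm_num [one_add_one_eq_two])).differentiableAt (by norm_num)
  have key (a b : Fin n) : pd a (pd b u) x
      = fderiv ℝ (fderiv ℝ u) x (EuclideanSpace.single a 1) (EuclideanSpace.single b 1) := by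
    have : fderiv ℝ (fun y => fderiv ℝ u y (EuclideanSpace.single b 1)) x
        = (fderiv ℝ (fderiv ℝ u) x).flip (EuclideanSpace.single b 1) := by
      rw [fderiv_clm_apply hd (differentiableAt_const _)]
      simp
    change fderiv ℝ (fun y => fderiv ℝ u y (EuclideanSpace.single b 1)) x _ = _
    rw [this]; rfl
  rw [key, key]
  exact hu.isSymmSndFDerivAt (by simp) _ _

lemma norm_fderiv_sq (u : E → ℝ) (x : E) : ‖fderiv ℝ u x‖ ^ 2 = ∑ i, pd i u x ^ 2 := by
  have h1 : ‖fderiv ℝ u x‖ = ‖gradient u x‖ := by simp [gradient]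
  have h2 (i : Fin n) : pd i u x = gradient u x i := by
    have : inner ℝ (gradient u x) (EuclideanSpace.single i (1 : ℝ)) = pd i u x := by
      simp [gradient, pd]
    rw [← this, EuclideanSpace.inner_single_right]; simp
  rw [h1, EuclideanSpace.norm_sq_eq]
  simp [h2]

lemma abs_pd_le (u : E → ℝ) (x : E) (i : Fin n) : |pd i u x| ≤ ‖fderiv ℝ u x‖ := by
  have := (fderiv ℝ u x).le_opNorm (EuclideanSpace.single i 1)
  simpa [pd] using this

lemma norm_gradient (u : E → ℝ) (x : E) : ‖gradient u x‖ = ‖fderiv ℝ u x‖ := by simp [gradient]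

lemma norm_clm_le (L : E →L[ℝ] ℝ) :
    ‖L‖ ≤ ∑ i, |L (EuclideanSpace.single i 1)| := by
  refine L.opNorm_le_bound (Finset.sum_nonneg fun i _ => abs_nonneg _) fun y => ?_
  conv_lhs => rw [← sum_single y]
  rw [map_sum, Finset.sum_mul]
  refine (norm_sum_le _ _).trans (Finset.sum_le_sum fun i _ => ?_)
  rw [map_smul, norm_smul, mul_comm, Real.norm_eq_abs]
  gcongr
  exact PiLp.norm_apply_le y i

/-- A continuously differentiable germ extends to the whole space. -/
lemma exists_contDiff_eventuallyEq {k : ℕ} {ψ : E → ℝ} {x : E} (h : ContDiffAt ℝ k ψ x) :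
    ∃ φ : E → ℝ, ContDiff ℝ k φ ∧ φ =ᶠ[𝓝 x] ψ := by
  have h1 : ∀ᶠ y in 𝓝 x, ContDiffAt ℝ k ψ y :=
    h.eventually (by exact_mod_cast ENat.natCast_ne_top _)
  obtain ⟨r, hr, hb⟩ := Metric.eventually_nhds_iff_ball.1 h1
  let f : ContDiffBump x := ⟨r / 4, r / 2, by positivity, by linarith⟩
  refine ⟨fun y => f y * ψ y, ?_, ?_⟩
  · rw [contDiff_iff_contDiffAt]
    intro y
    by_cases hy : y ∈ Metric.ball x r
    · exact (f.contDiff.contDiffAt).mul (hb y hy)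
    · have : y ∉ tsupport f := by
        rw [f.tsupport_eq]
        intro hy'
        apply hy
        refine Metric.closedBall_subset_ball ?_ hy'
        change r / 2 < r
        linarith
      have h2 : (fun y => f y * ψ y) =ᶠ[𝓝 y] fun _ => 0 := by
        filter_upwards [notMem_tsupport_iff_eventuallyEq.1 this] with z hz
        rw [hz]; simp
      exact (contDiffAt_const (c := (0:ℝ))).congr_of_eventuallyEq h2
  · filter_upwards [f.eventuallyEq_one] with y hy
    rw [hy]; simp

end Basics

section Averages

variable {n : ℕ}

local notation "E" => EuclideanSpace ℝ (Fin n)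

/-- Smooth functions vanishing outside the closed unit ball. -/
structure IsTest (φ : E → ℝ) : Prop where
  contDiff : ContDiff ℝ ∞ φ
  eq_zero : ∀ y, 1 < ‖y‖ → φ y = 0

lemma IsTest.continuous {φ : E → ℝ} (h : IsTest φ) : Continuous φ := h.contDiff.continuous

lemma IsTest.contDiff_two {φ : E → ℝ} (h : IsTest φ) : ContDiff ℝ 2 φ := by
  exact_mod_cast contDiff_infty.1 h.contDiff 2

lemma IsTest.hasCompactSupport {φ : E → ℝ} (h : IsTest φ) : HasCompactSupport φ := by
  refine HasCompactSupport.intro (isCompact_closedBall (0 : E) 1) fun y hy => h.eq_zero y ?_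
  simpa using hy

lemma IsTest.pd {φ : E → ℝ} (h : IsTest φ) (i : Fin n) : IsTest (pd i φ) := by
  refine ⟨h.contDiff.pd (m := ∞) (by norm_num) i, fun y hy => ?_⟩
  have : φ =ᶠ[𝓝 y] fun _ => 0 := by
    filter_upwards [(isOpen_lt continuous_const continuous_norm).mem_nhds hy] with z hz
    exact h.eq_zero z hz
  rw [pd_congr this]
  simp [_root_.pd]

lemma IsTest.coord_mul {φ : E → ℝ} (h : IsTest φ) (i : Fin n) : IsTest fun y => y i * φ y := by
  refine ⟨?_, fun y hy => by simp [h.eq_zero y hy]⟩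
  have : ContDiff ℝ ∞ fun y : E => y i := by fun_prop
  exact this.mul h.contDiff

/-- The average of `g` against the profile `φ` at scale `s` around `x`. -/
noncomputable def avg (φ g : E → ℝ) (x : E) (s : ℝ) : ℝ := ∫ y, g (x + s • y) * φ y

lemma integrable_avg {φ g : E → ℝ} (hφ : IsTest φ) (hg : Continuous g) (x : E) (s : ℝ) :
    Integrable fun y => g (x + s • y) * φ y :=
  ((by fun_prop : Continuous fun y => g (x + s • y)).mul
    hφ.continuous).integrable_of_hasCompactSupport hφ.hasCompactSupport.mul_left

lemma avg_zero (φ g : E → ℝ) (x : E) : avg φ g x 0 = (∫ y, φ y) * g x := by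
  simp only [avg, zero_smul, add_zero]
  rw [integral_const_mul, mul_comm]

lemma avg_add {φ g h : E → ℝ} (hφ : IsTest φ) (hg : Continuous g) (hh : Continuous h)
    (x : E) (s : ℝ) : avg φ (fun y => g y + h y) x s = avg φ g x s + avg φ h x s := by
  simp only [avg, add_mul]
  exact integral_add (integrable_avg hφ hg x s) (integrable_avg hφ hh x s)

lemma avg_sum {ι : Type*} (I : Finset ι) {φ : E → ℝ} {g : ι → E → ℝ} (hφ : IsTest φ)
    (hg : ∀ i, Continuous (g i)) (x : E) (s : ℝ) :
    avg φ (fun y => ∑ i ∈ I, g i y) x s = ∑ i ∈ I, avg φ (g i) x s := by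
  simp only [avg, Finset.sum_mul]
  exact integral_finsetSum _ fun i _ => integrable_avg hφ (hg i) x s

lemma avg_neg_left (φ g : E → ℝ) (x : E) (s : ℝ) :
    avg (fun y => -φ y) g x s = -avg φ g x s := by
  simp [avg, integral_neg]

lemma avg_add_left {φ ψ g : E → ℝ} (hφ : IsTest φ) (hψ : IsTest ψ) (hg : Continuous g)
    (x : E) (s : ℝ) : avg (fun y => φ y + ψ y) g x s = avg φ g x s + avg ψ g x s := by
  simp only [avg, mul_add]
  exact integral_add (integrable_avg hφ hg x s) (integrable_avg hψ hg x s)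

/-- Integration by parts for averages. -/
lemma mul_avg_pd {φ g : E → ℝ} (hφ : IsTest φ) (hg : ContDiff ℝ 1 g) (i : Fin n) (x : E) (s : ℝ) :
    s * avg φ (pd i g) x s = -avg (pd i φ) g x s := by
  have hd (y : E) : HasFDerivAt (fun y => g (x + s • y)) (s • fderiv ℝ g (x + s • y)) y := by
    have h1 : HasFDerivAt (fun y : E => x + s • y) (s • ContinuousLinearMap.id ℝ E) y :=
      ((hasFDerivAt_id y).const_smul s).const_add x
    have h2 := (hg.differentiable (by norm_num) (x + s • y)).hasFDerivAt.comp y h1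
    refine h2.congr_fderiv ?_
    ext z
    simp
  have h1 (y : E) : fderiv ℝ (fun y => g (x + s • y)) y (EuclideanSpace.single i 1)
      = s * pd i g (x + s • y) := by
    rw [(hd y).fderiv]; simp [pd]
  have hc : Continuous (pd i g) := hg.continuous_pd i
  have key := integral_mul_fderiv_eq_neg_fderiv_mul_of_integrable (μ := (volume : Measure E))
    (f := fun y => g (x + s • y)) (g := φ) (v := EuclideanSpace.single i 1) ?_ ?_ ?_
    (fun y _ => (hd y).differentiableAt)
    (fun y _ => hφ.contDiff.differentiable (by simp) y)
  · simp only [h1] at key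
    have h3 : avg (pd i φ) g x s = ∫ y, g (x + s • y) * fderiv ℝ φ y (EuclideanSpace.single i 1) :=
      rfl
    rw [h3, key, neg_neg, avg, ← integral_const_mul]
    simp only [mul_assoc]
  · simp only [h1, mul_assoc]
    exact (integrable_avg hφ hc x s).const_mul s
  · exact integrable_avg (hφ.pd i) hg.continuous x s
  · exact integrable_avg hφ hg.continuous x s

lemma hasDerivAt_avg {φ g : E → ℝ} (hφ : IsTest φ) (hg : ContDiff ℝ 1 g) (x : E) (s : ℝ) :
    HasDerivAt (avg φ g x) (∑ j, avg (fun y => y j * φ y) (pd j g) x s) s := by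
  have hcf : Continuous (fderiv ℝ g) := hg.continuous_fderiv (by norm_num)
  obtain ⟨M, hM⟩ := (isCompact_closedBall x (|s| + 1)).exists_bound_of_continuousOn hcf.continuousOn
  have key := hasDerivAt_integral_of_dominated_loc_of_deriv_le (μ := (volume : Measure E))
    (F := fun t y => g (x + t • y) * φ y)
    (F' := fun t y => fderiv ℝ g (x + t • y) y * φ y) (x₀ := s)
    (bound := fun y => M * ‖φ y‖) (Metric.ball_mem_nhds s one_pos)
    (Eventually.of_forall fun t => (integrable_avg hφ hg.continuous x t).aestronglyMeasurable)
    (integrable_avg hφ hg.continuous x s) ?_ ?_ ?_ ?_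
  · refine key.2.congr_deriv ?_
    have : ∀ y, fderiv ℝ g (x + s • y) y * φ y
        = ∑ j, pd j g (x + s • y) * (y j * φ y) := fun y => by
      rw [fderiv_apply_eq_sum, Finset.sum_mul]
      exact Finset.sum_congr rfl fun j _ => by ring
    simp only [this, avg]
    exact integral_finsetSum _ fun j _ => integrable_avg (hφ.coord_mul j) (hg.continuous_pd j) x s
  · exact (((hcf.comp (by fun_prop : Continuous fun y => x + s • y)).clm_apply
      continuous_id).mul hφ.continuous).aestronglyMeasurable
  · refine Eventually.of_forall fun y t ht => ?_
    by_cases hy : 1 < ‖y‖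
    · simp [hφ.eq_zero y hy]
    · push Not at hy
      have ht' : |t| ≤ |s| + 1 := by
        have h2 : |t - s| < 1 := by simpa [Real.dist_eq] using ht
        have := abs_sub_abs_le_abs_sub t s
        linarith
      have hb : x + t • y ∈ Metric.closedBall x (|s| + 1) := by
        rw [mem_closedBall_iff_norm]
        simp only [add_sub_cancel_left, norm_smul, Real.norm_eq_abs]
        nlinarith [norm_nonneg y, abs_nonneg t]
      rw [norm_mul]
      gcongr
      calc _ ≤ ‖fderiv ℝ g (x + t • y)‖ * ‖y‖ := ContinuousLinearMap.le_opNorm _ _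
        _ ≤ M * 1 := by
          gcongr
          · exact (norm_nonneg _).trans (hM _ hb)
          · exact hM _ hb
        _ = M := mul_one M
  · exact (hφ.continuous.norm.integrable_of_hasCompactSupport hφ.hasCompactSupport.norm).const_mul M
  · refine Eventually.of_forall fun y t _ => ?_
    have h1 : HasDerivAt (fun t : ℝ => x + t • y) y t := by
      simpa using ((hasDerivAt_id t).smul_const y).const_add x
    exact ((hg.differentiable (by norm_num) _).hasFDerivAt.comp_hasDerivAt t h1).mul_const _

lemma continuous_avg {φ g : E → ℝ} (hφ : IsTest φ) (hg : Continuous g) (x : E) :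
    Continuous (avg φ g x) := by
  rw [continuous_iff_continuousAt]
  intro s
  obtain ⟨M, hM⟩ := (isCompact_closedBall x (|s| + 1)).exists_bound_of_continuousOn hg.continuousOn
  refine continuousAt_of_dominated (bound := fun y => M * ‖φ y‖)
    (Eventually.of_forall fun t => (integrable_avg hφ hg x t).aestronglyMeasurable) ?_ ?_ ?_
  · filter_upwards [Metric.ball_mem_nhds s one_pos] with t ht
    refine Eventually.of_forall fun y => ?_
    by_cases hy : 1 < ‖y‖
    · simp [hφ.eq_zero y hy]
    · push Not at hy
      have ht' : |t| ≤ |s| + 1 := by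
        have h2 : |t - s| < 1 := by simpa [Real.dist_eq] using ht
        have := abs_sub_abs_le_abs_sub t s
        linarith
      have hb : x + t • y ∈ Metric.closedBall x (|s| + 1) := by
        rw [mem_closedBall_iff_norm]
        simp only [add_sub_cancel_left, norm_smul, Real.norm_eq_abs]
        nlinarith [norm_nonneg y, abs_nonneg t]
      rw [norm_mul]
      gcongr
      exact hM _ hb
  · exact (hφ.continuous.norm.integrable_of_hasCompactSupport hφ.hasCompactSupport.norm).const_mul M
  · refine Eventually.of_forall fun y => ?_
    fun_prop

lemma abs_avg_le {φ g : E → ℝ} (hφ : IsTest φ) {x : E} {s M : ℝ}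
    (hM : ∀ y, ‖y‖ ≤ 1 → |g (x + s • y)| ≤ M) :
    |avg φ g x s| ≤ M * ∫ y, ‖φ y‖ := by
  have hI := hφ.continuous.norm.integrable_of_hasCompactSupport hφ.hasCompactSupport.norm
    (μ := (volume : Measure E))
  rw [← integral_const_mul, ← Real.norm_eq_abs]
  refine norm_integral_le_of_norm_le (hI.const_mul M) (Eventually.of_forall fun y => ?_)
  by_cases hy : 1 < ‖y‖
  · simp [hφ.eq_zero y hy]
  · push Not at hy
    rw [norm_mul]
    gcongr
    exact hM y hy

/-- A pair of radial profiles related by `∇Θ = -y ζ`. -/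
structure IsKernelPair (Θ ζ : E → ℝ) : Prop where
  testΘ : IsTest Θ
  testζ : IsTest ζ
  nonnegΘ : ∀ y, 0 ≤ Θ y
  nonnegζ : ∀ y, 0 ≤ ζ y
  integralΘ : 0 < ∫ y, Θ y
  integralζ : 0 < ∫ y, ζ y
  pd_eq : ∀ i y, pd i Θ y = -(y i * ζ y)

lemma exists_isKernelPair (hn : 0 < n) : ∃ Θ ζ : E → ℝ, IsKernelPair Θ ζ := by
  have hst : ContDiff ℝ ∞ smoothTransition := smoothTransition.contDiff (n := ⊤)
  have hst' : ContDiff ℝ ∞ (deriv smoothTransition) := ((contDiff_infty_iff_deriv).1 hst).2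
  have hρ : ContDiff ℝ ∞ fun y : E => 1 - ‖y‖ ^ 2 := contDiff_const.sub (contDiff_norm_sq ℝ)
  have tΘ : IsTest fun y : E => smoothTransition (1 - ‖y‖ ^ 2) :=
    ⟨hst.comp hρ, fun y hy => smoothTransition.zero_of_nonpos (by nlinarith)⟩
  have tζ : IsTest fun y : E => 2 * deriv smoothTransition (1 - ‖y‖ ^ 2) := by
    refine ⟨contDiff_const.mul (hst'.comp hρ), fun y hy => ?_⟩
    have h0 : 1 - ‖y‖ ^ 2 < 0 := by nlinarith
    have : smoothTransition =ᶠ[𝓝 (1 - ‖y‖ ^ 2)] fun _ => 0 := by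
      filter_upwards [Iio_mem_nhds h0] with t ht
      exact smoothTransition.zero_of_nonpos ht.le
    simp [this.deriv_eq]
  have nζ : ∀ y : E, 0 ≤ 2 * deriv smoothTransition (1 - ‖y‖ ^ 2) := fun y =>
    mul_nonneg zero_le_two smoothTransition.monotone.deriv_nonneg
  refine ⟨_, _, tΘ, tζ, fun y => smoothTransition.nonneg _, nζ, ?_, ?_, ?_⟩
  · refine tΘ.continuous.integral_pos_of_hasCompactSupport_nonneg_nonzero tΘ.hasCompactSupport
      (fun y => smoothTransition.nonneg _) (x := 0) ?_
    simp
  · obtain ⟨t, ht, hd⟩ := exists_deriv_eq_slope smoothTransition one_pos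
      hst.continuous.continuousOn (hst.differentiable (by simp)).differentiableOn
    refine tζ.continuous.integral_pos_of_hasCompactSupport_nonneg_nonzero tζ.hasCompactSupport
      nζ (x := EuclideanSpace.single ⟨0, hn⟩ (√(1 - t))) ?_
    have : ‖(EuclideanSpace.single ⟨0, hn⟩ (√(1 - t)) : E)‖ ^ 2 = 1 - t := by
      rw [PiLp.norm_single, Real.norm_eq_abs, sq_abs, Real.sq_sqrt (by linarith [ht.2])]
    rw [this, sub_sub_cancel, hd]
    simp
  · intro i y
    have h1 : HasFDerivAt (fun y : E => 1 - ‖y‖ ^ 2) (-(2 • innerSL ℝ y)) y :=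
      (hasStrictFDerivAt_norm_sq y).hasFDerivAt.const_sub 1
    have h2 := ((hst.differentiable (by simp) (1 - ‖y‖ ^ 2)).hasDerivAt).comp_hasFDerivAt y h1
    change fderiv ℝ (smoothTransition ∘ fun y : E => 1 - ‖y‖ ^ 2) y _ = _
    rw [h2.fderiv]
    simp [EuclideanSpace.inner_single_right]
    ring

lemma IsKernelPair.coord_mul_eq {Θ ζ : E → ℝ} (h : IsKernelPair Θ ζ) (j : Fin n) :
    (fun y : E => y j * ζ y) = fun y => -pd j Θ y := by
  ext y; rw [h.pd_eq]; ring

lemma IsKernelPair.hasDerivAt_avg {Θ ζ : E → ℝ} (h : IsKernelPair Θ ζ) {F : E → ℝ}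
    (hF : ContDiff ℝ 2 F) (x : E) (s : ℝ) : HasDerivAt (avg ζ F x) (s * avg Θ (elaplacian F) x s) s := by
  refine (_root_.hasDerivAt_avg h.testζ (hF.of_le one_le_two) x s).congr_deriv ?_
  have h1 : elaplacian F = fun y => ∑ i, pd i (pd i F) y := rfl
  rw [h1, avg_sum _ h.testΘ (fun i => (hF.pd_one i).continuous_pd i), Finset.mul_sum]
  refine Finset.sum_congr rfl fun j _ => ?_
  rw [mul_avg_pd h.testΘ (hF.pd_one j), h.coord_mul_eq, avg_neg_left]

lemma IsTest.avg_pd_pd_comm {φ u : E → ℝ} (hφ : IsTest φ) (hu : ContDiff ℝ 2 u) (i j : Fin n)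
    (x : E) (s : ℝ) :
    s * avg (_root_.pd j φ) (_root_.pd j (_root_.pd i u)) x s
      = s * avg (_root_.pd i φ) (_root_.pd j (_root_.pd j u)) x s := by
  have h1 : _root_.pd j (_root_.pd i u) = _root_.pd i (_root_.pd j u) := by
    ext y; exact pd_comm hu.contDiffAt _ _
  have h2 : _root_.pd i (_root_.pd j φ) = _root_.pd j (_root_.pd i φ) := by
    ext y; exact pd_comm hφ.contDiff_two.contDiffAt _ _
  rw [h1, mul_avg_pd (hφ.pd j) (hu.pd_one j), h2, ← mul_avg_pd (hφ.pd i) (hu.pd_one j)]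

lemma IsKernelPair.hasDerivAt_avg_pd {Θ ζ : E → ℝ} (h : IsKernelPair Θ ζ) {u : E → ℝ}
    (hu : ContDiff ℝ 2 u) (i : Fin n) (x : E) {s : ℝ} (hs : s ≠ 0) :
    HasDerivAt (avg ζ (pd i u) x) (-avg (pd i Θ) (elaplacian u) x s) s := by
  refine (_root_.hasDerivAt_avg h.testζ (hu.pd_one i) x s).congr_deriv ?_
  have h1 : elaplacian u = fun y => ∑ i, pd i (pd i u) y := rfl
  rw [h1, avg_sum _ (h.testΘ.pd i) (fun i => (hu.pd_one i).continuous_pd i),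
    ← Finset.sum_neg_distrib]
  refine Finset.sum_congr rfl fun j _ => ?_
  rw [h.coord_mul_eq, avg_neg_left]
  exact congrArg _ (mul_left_cancel₀ hs (h.testΘ.avg_pd_pd_comm hu i j x s))

lemma IsKernelPair.hasDerivAt_avg_pd_pd {Θ ζ : E → ℝ} (h : IsKernelPair Θ ζ) {u : E → ℝ}
    (hu : ContDiff ℝ 2 u) (i j : Fin n) (x : E) {s : ℝ} (hs : s ≠ 0) :
    HasDerivAt (avg ζ (pd i (pd j u)) x)
      (s⁻¹ * avg (pd j (pd i Θ)) (elaplacian u) x s) s := by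
  have hpi (k : Fin n) : (fun y : E => y k * pd i ζ y)
      = fun y => -pd k (pd i Θ) y + -(if i = k then ζ y else 0) := by
    ext y
    have h1 : pd i (pd k Θ) y = -(y k * pd i ζ y) + -(if i = k then ζ y else 0) := by
      have h2 : pd k Θ = fun y => -(y k * ζ y) := funext fun y => h.pd_eq k y
      have h3 : HasFDerivAt (fun y : E => y k) (EuclideanSpace.proj k : E →L[ℝ] ℝ) y :=
        (EuclideanSpace.proj k : E →L[ℝ] ℝ).hasFDerivAt
      have h4 := (h3.mul (h.testζ.contDiff.differentiable (by simp) y).hasFDerivAt).neg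
      rw [h2]
      change fderiv ℝ (-((fun y : E => y k) * ζ)) y _ = _
      rw [h4.fderiv]
      by_cases hik : i = k
      · subst hik
        simp [pd]
        ring
      · simp [pd, hik, Ne.symm hik]
    rw [pd_comm h.testΘ.contDiff_two.contDiffAt, h1]
    ring
  have h1 : elaplacian u = fun y => ∑ k, pd k (pd k u) y := rfl
  have hE : avg ζ (pd i (pd j u)) x =ᶠ[𝓝 s] fun t => t⁻¹ * -avg (pd i ζ) (pd j u) x t := by
    filter_upwards [isOpen_ne.mem_nhds hs] with t ht
    rw [← mul_avg_pd h.testζ (hu.pd_one j), inv_mul_cancel_left₀ ht]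
  have hd := (hasDerivAt_inv hs).mul
    (_root_.hasDerivAt_avg (h.testζ.pd i) (hu.pd_one j) x s).neg
  refine (hd.congr_of_eventuallyEq hE).congr_deriv ?_
  have h2 : ∑ k, avg (fun y => y k * pd i ζ y) (pd k (pd j u)) x s
      = -avg (pd j (pd i Θ)) (elaplacian u) x s - avg ζ (pd i (pd j u)) x s := by
    have h3 (k : Fin n) : avg (fun y => y k * pd i ζ y) (pd k (pd j u)) x s
        = -avg (pd j (pd i Θ)) (pd k (pd k u)) x s
          - if i = k then avg ζ (pd k (pd j u)) x s else 0 := by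
      have hc : Continuous (pd k (pd j u)) := (hu.pd_one j).continuous_pd k
      rw [hpi]
      by_cases hik : i = k
      · subst hik
        simp only [if_true]
        rw [avg_add_left (φ := fun y => -pd i (pd i Θ) y) (ψ := fun y => -ζ y)
          ⟨((h.testΘ.pd i).pd i).contDiff.neg, fun y hy => by
            simp [((h.testΘ.pd i).pd i).eq_zero y hy]⟩
          ⟨h.testζ.contDiff.neg, fun y hy => by simp [h.testζ.eq_zero y hy]⟩ hc, avg_neg_left,
          avg_neg_left, mul_left_cancel₀ hs ((h.testΘ.pd i).avg_pd_pd_comm hu j i x s)]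
        ring
      · simp only [hik, if_false, neg_zero, add_zero, sub_zero]
        rw [avg_neg_left, mul_left_cancel₀ hs ((h.testΘ.pd i).avg_pd_pd_comm hu j k x s)]
    simp only [h3, Finset.sum_sub_distrib, Finset.sum_ite_eq, Finset.mem_univ, if_true,
      Finset.sum_neg_distrib]
    rw [h1, avg_sum _ ((h.testΘ.pd i).pd j) (fun k => (hu.pd_one k).continuous_pd k)]
  rw [Pi.neg_apply, h2, ← mul_avg_pd h.testζ (hu.pd_one j)]
  field_simp
  ring

end Averages

section Bochner

variable {n : ℕ}

local notation "E" => EuclideanSpace ℝ (Fin n)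

lemma avg_congr {φ g h : E → ℝ} (hφ : IsTest φ) {x : E} {s : ℝ}
    (H : ∀ y, ‖y‖ ≤ 1 → g (x + s • y) = h (x + s • y)) : avg φ g x s = avg φ h x s := by
  refine integral_congr_ae (Eventually.of_forall fun y => ?_)
  by_cases hy : 1 < ‖y‖
  · simp [hφ.eq_zero y hy]
  · simp [H y (not_lt.1 hy)]

lemma le_avg {φ g : E → ℝ} (hφ : IsTest φ) (h0 : ∀ y, 0 ≤ φ y) (hg : Continuous g) {x : E}
    {s a : ℝ} (H : ∀ y, ‖y‖ ≤ 1 → a ≤ g (x + s • y)) : a * ∫ y, φ y ≤ avg φ g x s := by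
  rw [← integral_const_mul]
  refine integral_mono ((hφ.continuous.integrable_of_hasCompactSupport
    hφ.hasCompactSupport).const_mul a) (integrable_avg hφ hg x s) fun y => ?_
  by_cases hy : 1 < ‖y‖
  · simp [hφ.eq_zero y hy]
  · exact mul_le_mul_of_nonneg_right (H y (not_lt.1 hy)) (h0 y)

lemma avg_le {φ g : E → ℝ} (hφ : IsTest φ) (h0 : ∀ y, 0 ≤ φ y) (hg : Continuous g) {x : E}
    {s a : ℝ} (H : ∀ y, ‖y‖ ≤ 1 → g (x + s • y) ≤ a) : avg φ g x s ≤ a * ∫ y, φ y := by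
  rw [← integral_const_mul]
  refine integral_mono (integrable_avg hφ hg x s) ((hφ.continuous.integrable_of_hasCompactSupport
    hφ.hasCompactSupport).const_mul a) fun y => ?_
  by_cases hy : 1 < ‖y‖
  · simp [hφ.eq_zero y hy]
  · exact mul_le_mul_of_nonneg_right (H y (not_lt.1 hy)) (h0 y)

/-- Second-order necessary condition at a local maximum for `∑ ∂ᵢ uᵢ + ψ`, where only the
Laplacians of the `uᵢ` are assumed to be differentiable. -/
lemma sum_pd_add_elaplacian_nonpos (hn : 0 < n) {u g : Fin n → E → ℝ} {ψ : E → ℝ} {x : E}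
    (hu : ∀ i, ContDiff ℝ 2 (u i)) (hg : ∀ i, ContDiff ℝ 1 (g i))
    (hug : ∀ i, elaplacian (u i) =ᶠ[𝓝 x] g i) (hψ : ContDiff ℝ 2 ψ)
    (hmax : IsLocalMax (fun y => ∑ i, pd i (u i) y + ψ y) x) :
    ∑ i, pd i (g i) x + elaplacian ψ x ≤ 0 := by
  by_contra! hpos
  obtain ⟨Θ, ζ, hk⟩ := exists_isKernelPair hn
  set G : E → ℝ := fun y => ∑ i, pd i (g i) y + elaplacian ψ y with hG
  set F : E → ℝ := fun y => ∑ i, pd i (u i) y + ψ y with hF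
  have cpg (i : Fin n) : Continuous (pd i (g i)) := (hg i).continuous_pd i
  have cpu (i : Fin n) : Continuous (pd i (u i)) := ((hu i).of_le one_le_two).continuous_pd i
  have cG : Continuous G := (continuous_finsetSum _ fun i _ => cpg i).add hψ.continuous_elaplacian
  have cF : Continuous F := (continuous_finsetSum _ fun i _ => cpu i).add hψ.continuous
  have hpos' : 0 < G x := hpos
  have ev : ∀ᶠ y in 𝓝 x, G x / 2 < G y ∧ (∀ i, elaplacian (u i) y = g i y) ∧ F y ≤ F x :=
    (cG.continuousAt.eventually_const_lt (by linarith)).and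
      ((eventually_all.2 hug).and hmax)
  obtain ⟨r, hr, hb⟩ := Metric.eventually_nhds_iff_ball.1 ev
  have hin {s : ℝ} (hs : 0 ≤ s) (hsr : s < r) (y : E) (hy : ‖y‖ ≤ 1) :
      x + s • y ∈ Metric.ball x r := by
    rw [mem_ball_iff_norm]
    simp only [add_sub_cancel_left, norm_smul, Real.norm_eq_abs, abs_of_nonneg hs]
    nlinarith
  have hsplit (s : ℝ) : avg ζ F x s = ∑ i, avg ζ (pd i (u i)) x s + avg ζ ψ x s := by
    rw [hF, avg_add hk.testζ (continuous_finsetSum _ fun i _ => cpu i) hψ.continuous,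
      avg_sum _ hk.testζ cpu]
  have hder (s : ℝ) (hs : 0 < s) (hsr : s < r) :
      HasDerivAt (avg ζ F x) (s * avg Θ G x s) s := by
    have h1 := (HasDerivAt.fun_sum fun i (_ : i ∈ Finset.univ) =>
      hk.hasDerivAt_avg_pd (hu i) i x hs.ne').add (hk.hasDerivAt_avg hψ x s)
    rw [show avg ζ F x = _ from funext hsplit]
    refine h1.congr_deriv ?_
    rw [hG, avg_add hk.testΘ (continuous_finsetSum _ fun i _ => cpg i) hψ.continuous_elaplacian,
      avg_sum _ hk.testΘ cpg, mul_add, Finset.mul_sum]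
    congr 1
    refine Finset.sum_congr rfl fun i _ => ?_
    rw [mul_avg_pd hk.testΘ (hg i)]
    congr 1
    exact avg_congr (hk.testΘ.pd i) fun y hy => (hb _ (hin hs.le hsr y hy)).2.1 i
  have hmono : StrictMonoOn (avg ζ F x) (Icc 0 (r / 2)) := by
    refine strictMonoOn_of_deriv_pos (convex_Icc _ _) (continuous_avg hk.testζ cF x).continuousOn
      fun s hs => ?_
    rw [interior_Icc] at hs
    rw [(hder s hs.1 (by linarith [hs.2])).deriv]
    have := le_avg hk.testΘ hk.nonnegΘ cG (x := x) (s := s) (a := G x / 2)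
      fun y hy => (hb _ (hin hs.1.le (by linarith [hs.2]) y hy)).1.le
    have h2 : 0 < G x / 2 * ∫ y, Θ y := mul_pos (by linarith) hk.integralΘ
    exact mul_pos hs.1 (by linarith)
  have h1 := hmono (left_mem_Icc.2 (by positivity)) (right_mem_Icc.2 (by positivity))
    (by positivity : (0 : ℝ) < r / 2)
  have h2 := avg_le hk.testζ hk.nonnegζ cF (x := x) (s := r / 2) (a := F x)
    fun y hy => (hb _ (hin (by positivity) (by linarith) y hy)).2.2
  rw [avg_zero] at h1
  linarith

lemma elaplacian_nonpos_of_isLocalMax (hn : 0 < n) {ψ : E → ℝ} {x : E} (hψ : ContDiff ℝ 2 ψ)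
    (hmax : IsLocalMax ψ x) : elaplacian ψ x ≤ 0 := by
  have hz (i : Fin n) : pd i (fun _ : E => (0 : ℝ)) = fun _ => 0 := by ext; simp [pd]
  have := sum_pd_add_elaplacian_nonpos hn (u := fun _ _ => 0) (g := fun _ _ => 0) (ψ := ψ) (x := x)
    (fun _ => contDiff_const) (fun _ => contDiff_const)
    (fun i => Eventually.of_forall fun y => by simp [elaplacian_eq, hz]) hψ
    (by simpa [hz] using hmax)
  simpa [hz] using this

section Calculus

variable {f g : EuclideanSpace ℝ (Fin n) → ℝ} {x : EuclideanSpace ℝ (Fin n)} (i : Fin n)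

lemma pd_add (hf : DifferentiableAt ℝ f x) (hg : DifferentiableAt ℝ g x) :
    pd i (fun y => f y + g y) x = pd i f x + pd i g x := by
  simp [pd, fderiv_fun_add hf hg]

lemma pd_sub (hf : DifferentiableAt ℝ f x) (hg : DifferentiableAt ℝ g x) :
    pd i (fun y => f y - g y) x = pd i f x - pd i g x := by
  simp [pd, fderiv_fun_sub hf hg]

lemma pd_mul (hf : DifferentiableAt ℝ f x) (hg : DifferentiableAt ℝ g x) :
    pd i (fun y => f y * g y) x = pd i f x * g x + f x * pd i g x := by
  simp [pd, fderiv_fun_mul hf hg]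
  ring

lemma pd_const_mul (c : ℝ) (hf : DifferentiableAt ℝ f x) :
    pd i (fun y => c * f y) x = c * pd i f x := by
  simp [pd, fderiv_const_mul hf]

lemma pd_sum {ι : Type*} {I : Finset ι} {f : ι → E → ℝ} (hf : ∀ j, DifferentiableAt ℝ (f j) x) :
    pd i (fun y => ∑ j ∈ I, f j y) x = ∑ j ∈ I, pd i (f j) x := by
  simp [pd, fderiv_fun_sum fun j _ => hf j]

lemma pd_comp {ρ : ℝ → ℝ} {ρ' : ℝ} (hρ : HasDerivAt ρ ρ' (f x)) (hf : DifferentiableAt ℝ f x) :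
    pd i (fun y => ρ (f y)) x = ρ' * pd i f x := by
  have := hρ.comp_hasFDerivAt x hf.hasFDerivAt
  change fderiv ℝ (ρ ∘ f) x _ = _
  rw [this.fderiv]
  simp [pd]

lemma pd_coord (j : Fin n) : pd i (fun y : E => y j) x = if i = j then 1 else 0 := by
  have h3 : HasFDerivAt (fun y : E => y j) (EuclideanSpace.proj j : E →L[ℝ] ℝ) x :=
    (EuclideanSpace.proj j : E →L[ℝ] ℝ).hasFDerivAt
  rw [pd, h3.fderiv]
  simp [eq_comm]

end Calculus

/-- Bochner's inequality at a point where `|∇w|²` is touched from above by `Ψ`. -/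
lemma bochner_le_of_touching (hn : 0 < n) {w Ψ : E → ℝ} {x : E} (hw : ContDiff ℝ 2 w)
    (hΔ : ContDiffAt ℝ 1 (elaplacian w) x) (hΨ : ContDiffAt ℝ 2 Ψ x)
    (hle : ∀ᶠ y in 𝓝 x, ∑ i, pd i w y ^ 2 ≤ Ψ y) (heq : ∑ i, pd i w x ^ 2 = Ψ x) :
    2 * ∑ i, pd i w x * pd i (elaplacian w) x + 2 * ∑ i, ∑ j, pd j (pd i w) x ^ 2
      ≤ elaplacian Ψ x := by
  obtain ⟨D, hD, hDe⟩ := exists_contDiff_eventuallyEq (k := 1) (by exact_mod_cast hΔ)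
  obtain ⟨P, hP, hPe⟩ := exists_contDiff_eventuallyEq (k := 2) (by exact_mod_cast hΨ)
  replace hD : ContDiff ℝ 1 D := by exact_mod_cast hD
  replace hP : ContDiff ℝ 2 P := by exact_mod_cast hP
  rw [← elaplacian_congr hPe]
  simp only [← pd_congr hDe]
  set b : Fin n → Fin n → ℝ := fun i j => pd j (pd i w) x with hb
  have bsymm (i j : Fin n) : b i j = b j i := pd_comm hw.contDiffAt _ _
  set η : Fin n → E → ℝ := fun i y => pd i w x + ∑ j, b i j * (y j - x j) with hη
  have hηc (i : Fin n) : ContDiff ℝ 2 (η i) := by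
    refine contDiff_const.add (ContDiff.sum fun j _ => ?_)
    fun_prop
  have hηd (i : Fin n) (y : E) : DifferentiableAt ℝ (η i) y := (hηc i).differentiable (by simp) y
  have hηx (i : Fin n) : η i x = pd i w x := by simp [hη]
  have hηp (i j : Fin n) (y : E) : pd j (η i) y = b i j := by
    have hcd (k : Fin n) : DifferentiableAt ℝ (fun y : E => y k - x k) y := by fun_prop
    rw [hη]
    dsimp only
    rw [pd_add j (differentiableAt_const _) (DifferentiableAt.fun_sum fun k _ =>
      (hcd k).const_mul _), pd_sum j fun k => (hcd k).const_mul _]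
    have (k : Fin n) :
        pd j (fun y : E => b i k * (y k - x k)) y = if j = k then b i k else 0 := by
      rw [pd_const_mul j _ (hcd k), pd_sub j (by fun_prop) (by fun_prop), pd_coord]
      simp [pd]
    simp only [this]
    simp [pd]
  have hwd (y : E) : DifferentiableAt ℝ w y := hw.differentiable (by simp) y
  have hpd (i : Fin n) (y : E) : DifferentiableAt ℝ (pd i w) y :=
    (hw.pd_one i).differentiable (by simp) y
  have hPd (y : E) : DifferentiableAt ℝ P y := hP.differentiable (by simp) y
  have hPpd (i : Fin n) (y : E) : DifferentiableAt ℝ (pd i P) y :=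
    (hP.pd_one i).differentiable (by simp) y
  have hDd (y : E) : DifferentiableAt ℝ D y := hD.differentiable (by simp) y
  have hpu (i j : Fin n) : pd j (fun y => 2 * (η i y * w y))
      = fun y => 2 * (b i j * w y + η i y * pd j w y) := by
    ext y
    rw [pd_const_mul j _ ((hηd i y).fun_mul (hwd y)), pd_mul j (hηd i y) (hwd y), hηp]
  have hlu (i : Fin n) (y : E) : elaplacian (fun y => 2 * (η i y * w y)) y
      = 2 * (η i y * elaplacian w y + 2 * ∑ j, b i j * pd j w y) := by
    simp only [elaplacian_eq, hpu]
    rw [Finset.mul_sum, Finset.mul_sum, ← Finset.sum_add_distrib, Finset.mul_sum]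
    refine Finset.sum_congr rfl fun j _ => ?_
    rw [pd_const_mul j _ (((hwd y).const_mul _).fun_add ((hηd i y).fun_mul (hpd j y))),
      pd_add j ((hwd y).const_mul _) ((hηd i y).fun_mul (hpd j y)), pd_const_mul j _ (hwd y),
      pd_mul j (hηd i y) (hpd j y), hηp]
    ring
  obtain ⟨τ, hτ⟩ : ∃ τ, τ = ∑ i, b i i := ⟨_, rfl⟩
  have key := sum_pd_add_elaplacian_nonpos hn (x := x)
    (u := fun i y => 2 * (η i y * w y))
    (g := fun i y => 2 * (η i y * D y + 2 * ∑ j, b i j * pd j w y))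
    (ψ := fun y => -(2 * τ) * w y - ∑ i, η i y * η i y - P y)
    (fun i => contDiff_const.mul ((hηc i).mul hw))
    (fun i => contDiff_const.mul ((((hηc i).of_le one_le_two).mul hD).add
      (contDiff_const.mul (ContDiff.sum fun j _ => contDiff_const.mul (hw.pd_one j)))))
    (fun i => by
      filter_upwards [hDe] with y hy
      rw [hlu, hy])
    (((contDiff_const.mul hw).sub (ContDiff.sum fun i _ => (hηc i).mul (hηc i))).sub hP)
    ?_
  · have e1 (i : Fin n) : pd i (fun y => 2 * (η i y * D y + 2 * ∑ j, b i j * pd j w y)) x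
        = 2 * (b i i * D x) + 2 * (pd i w x * pd i D x) + 4 * ∑ j, b i j ^ 2 := by
      have hs : DifferentiableAt ℝ (fun y => ∑ j, b i j * pd j w y) x :=
        DifferentiableAt.fun_sum fun j _ => (hpd j x).const_mul _
      rw [pd_const_mul i _ (((hηd i x).fun_mul (hDd x)).fun_add (hs.const_mul _)),
        pd_add i ((hηd i x).fun_mul (hDd x)) (hs.const_mul _), pd_mul i (hηd i x) (hDd x), hηp, hηx,
        pd_const_mul i _ hs, pd_sum i fun j => (hpd j x).const_mul _]
      have : ∀ j, pd i (fun y => b i j * pd j w y) x = b i j ^ 2 := fun j => by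
        rw [pd_const_mul i _ (hpd j x), sq]
        congr 1
        exact bsymm j i
      simp only [this]
      ring
    have e2 : elaplacian (fun y => -(2 * τ) * w y - ∑ i, η i y * η i y - P y) x
        = -(2 * τ) * elaplacian w x - 2 * ∑ i, ∑ j, b i j ^ 2 - elaplacian P x := by
      have hs (y : E) : DifferentiableAt ℝ (fun y => ∑ i, η i y * η i y) y :=
        DifferentiableAt.fun_sum fun i _ => (hηd i y).fun_mul (hηd i y)
      have f1 (j : Fin n) : pd j (fun y => -(2 * τ) * w y - ∑ i, η i y * η i y - P y)
          = fun y => -(2 * τ) * pd j w y - ∑ i, (2 * b i j) * η i y - pd j P y := by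
        ext y
        rw [pd_sub j (((hwd y).const_mul _).fun_sub (hs y)) (hPd y),
          pd_sub j ((hwd y).const_mul _) (hs y), pd_const_mul j _ (hwd y),
          pd_sum j fun i => (hηd i y).fun_mul (hηd i y)]
        congr 2
        refine Finset.sum_congr rfl fun i _ => ?_
        rw [pd_mul j (hηd i y) (hηd i y), hηp]
        ring
      simp only [elaplacian_eq, f1]
      rw [Finset.sum_comm (γ := Fin n), Finset.mul_sum, Finset.mul_sum, ← Finset.sum_sub_distrib,
        ← Finset.sum_sub_distrib]
      refine Finset.sum_congr rfl fun j _ => ?_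
      have hs' : DifferentiableAt ℝ (fun y => ∑ i, (2 * b i j) * η i y) x :=
        DifferentiableAt.fun_sum fun i _ => (hηd i x).const_mul _
      rw [pd_sub j (((hpd j x).const_mul _).fun_sub hs') (hPpd j x),
        pd_sub j ((hpd j x).const_mul _) hs', pd_const_mul j _ (hpd j x),
        pd_sum j fun i => (hηd i x).const_mul _, Finset.mul_sum]
      congr 2
      refine Finset.sum_congr rfl fun i _ => ?_
      rw [pd_const_mul j _ (hηd i x), hηp]
      ring
    rw [e2] at key
    simp only [e1, Finset.sum_add_distrib, ← Finset.mul_sum, ← Finset.sum_mul] at key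
    rw [← hτ, hDe.eq_of_nhds] at key
    linarith
  · have hval (y : E) : ∑ i, pd i (fun y => 2 * (η i y * w y)) y
        + (-(2 * τ) * w y - ∑ i, η i y * η i y - P y)
        = ∑ i, pd i w y ^ 2 - P y - ∑ i, (pd i w y - η i y) ^ 2 := by
      simp only [hpu]
      have : ∑ i, 2 * (b i i * w y + η i y * pd i w y)
          = 2 * τ * w y + ∑ i, 2 * (η i y * pd i w y) := by
        rw [hτ, Finset.mul_sum, Finset.sum_mul, ← Finset.sum_add_distrib]
        exact Finset.sum_congr rfl fun i _ => by ring
      rw [this]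
      have h2 : ∑ i, (pd i w y - η i y) ^ 2
          = ∑ i, pd i w y ^ 2 - ∑ i, 2 * (η i y * pd i w y) + ∑ i, η i y * η i y := by
        rw [← Finset.sum_sub_distrib, ← Finset.sum_add_distrib]
        exact Finset.sum_congr rfl fun i _ => by ring
      rw [h2]
      ring
    change ∀ᶠ y in 𝓝 x, _ ≤ _
    filter_upwards [hle, hPe] with y hy hyP
    rw [hval, hval]
    have h1 : 0 ≤ ∑ i, (pd i w y - η i y) ^ 2 := Finset.sum_nonneg fun i _ => sq_nonneg _
    have h2 : ∑ i, (pd i w x - η i x) ^ 2 = 0 := by simp [hηx]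
    rw [h2, heq, hPe.eq_of_nhds, hyP]
    linarith

end Bochner

section Bernstein

variable {n : ℕ}

local notation "E" => EuclideanSpace ℝ (Fin n)

/-- The squared length of the gradient. -/
noncomputable def gradSq (w : E → ℝ) (x : E) : ℝ := ∑ i, pd i w x ^ 2

lemma gradSq_eq (w : E → ℝ) (x : E) : gradSq w x = ‖fderiv ℝ w x‖ ^ 2 := (norm_fderiv_sq w x).symm

lemma gradSq_nonneg (w : E → ℝ) (x : E) : 0 ≤ gradSq w x := Finset.sum_nonneg fun _ _ => sq_nonneg _

lemma ContDiff.gradSq {w : E → ℝ} (hw : ContDiff ℝ 2 w) : ContDiff ℝ 1 (gradSq w) :=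
  ContDiff.sum fun i _ => (hw.pd_one i).pow 2

/-- The paraboloid cap vanishing on the sphere of radius `R` around `a`. -/
noncomputable def cap (a : E) (R : ℝ) (y : E) : ℝ := R ^ 2 - ∑ j, (y j - a j) ^ 2

lemma cap_eq (a : E) (R : ℝ) (y : E) : cap a R y = R ^ 2 - ‖y - a‖ ^ 2 := by
  simp [cap, EuclideanSpace.norm_sq_eq]

lemma contDiff_cap {k : ℕ∞ω} (a : E) (R : ℝ) : ContDiff ℝ k (cap a R) := by
  unfold cap
  fun_prop

lemma pd_cap (a : E) (R : ℝ) (i : Fin n) (y : E) : pd i (cap a R) y = -2 * (y i - a i) := by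
  have hd (j : Fin n) : DifferentiableAt ℝ (fun y : E => y j - a j) y := by fun_prop
  have h1 (j : Fin n) : pd i (fun y : E => (y j - a j) ^ 2) y
      = if i = j then 2 * (y j - a j) else 0 := by
    rw [pd_comp i (ρ := fun t => t ^ 2) (hasDerivAt_pow 2 _) (hd j), pd_sub i (by fun_prop)
      (by fun_prop), pd_coord]
    simp [pd]
  change pd i (fun y => R ^ 2 - ∑ j, (y j - a j) ^ 2) y = _
  rw [pd_sub i (by fun_prop) (by fun_prop), pd_sum i fun j => (hd j).fun_pow 2]
  simp only [h1]
  simp [pd]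

lemma pd_cap_rpow {a : E} {R κ K : ℝ} (i : Fin n) {y : E} (hy : 0 < cap a R y) :
    pd i (fun y => K * cap a R y ^ (-κ)) y
      = 2 * κ * K * (cap a R y ^ (-κ - 1) * (y i - a i)) := by
  have hd : DifferentiableAt ℝ (cap a R) y := (contDiff_cap (k := 1) a R).differentiable (by simp) y
  rw [pd_const_mul i _ (hd.rpow_const (Or.inl hy.ne')),
    pd_comp i (ρ := fun t => t ^ (-κ)) (Real.hasDerivAt_rpow_const (Or.inl hy.ne')) hd, pd_cap]
  ring

lemma elaplacian_cap_rpow {a : E} {R κ K : ℝ} {x : E} (hx : 0 < cap a R x) :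
    elaplacian (fun y => K * cap a R y ^ (-κ)) x
      = K * cap a R x ^ (-κ) * (4 * κ * (κ + 1) * (∑ i, (x i - a i) ^ 2) / cap a R x ^ 2
        + 2 * n * κ / cap a R x) := by
  have hev : ∀ᶠ y in 𝓝 x, 0 < cap a R y :=
    (contDiff_cap (k := 1) a R).continuous.continuousAt.eventually_const_lt hx
  have hd : DifferentiableAt ℝ (cap a R) x := (contDiff_cap (k := 1) a R).differentiable (by simp) x
  have h1 (i : Fin n) : pd i (pd i (fun y => K * cap a R y ^ (-κ))) x
      = K * cap a R x ^ (-κ) * (4 * κ * (κ + 1) / cap a R x ^ 2 * (x i - a i) ^ 2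
        + 2 * κ / cap a R x) := by
    rw [pd_congr (hev.mono fun y hy => pd_cap_rpow i hy) i,
      pd_const_mul i _ ((hd.rpow_const (Or.inl hx.ne')).fun_mul (by fun_prop)),
      pd_mul i (hd.rpow_const (Or.inl hx.ne')) (by fun_prop),
      pd_comp i (ρ := fun t => t ^ (-κ - 1)) (Real.hasDerivAt_rpow_const (Or.inl hx.ne')) hd, pd_cap,
      pd_sub i (by fun_prop) (by fun_prop), pd_coord, rpow_sub_one hx.ne', rpow_sub_one hx.ne']
    simp [pd]
    field_simp
    ring
  rw [elaplacian_eq]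
  simp only [h1]
  rw [← Finset.mul_sum, Finset.sum_add_distrib, ← Finset.mul_sum]
  simp only [Finset.sum_const, Finset.card_univ, Fintype.card_fin, nsmul_eq_mul]
  ring

lemma sq_elaplacian_le (w : E → ℝ) (x : E) :
    elaplacian w x ^ 2 ≤ n * ∑ i, ∑ j, pd j (pd i w) x ^ 2 := by
  rw [elaplacian_eq]
  refine (sq_sum_le_card_mul_sum_sq).trans ?_
  simp only [Finset.card_univ, Fintype.card_fin]
  gcongr with i
  exact Finset.single_le_sum (f := fun j => pd j (pd i w) x ^ 2) (fun j _ => sq_nonneg _)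
    (Finset.mem_univ i)

lemma bernstein_arith {z S Φ R t ρ κ q m N : ℝ} (hz : 0 < z) (hS : 0 ≤ S) (hΦ : 0 < Φ) (hR : 0 < R)
    (hκ : 0 < κ) (hq : 0 ≤ q) (hN : 0 < N) (hρ : Φ = R ^ 2 - ρ) (hρ0 : 0 ≤ ρ) (ht : t ≤ √z * √ρ)
    (hB : 2 * (-(1 + q / 2 * (S / z)) * (2 * κ * z / Φ * t) - m * S * z) + 2 * ((z + S) ^ 2 / N)
      ≤ z * (4 * κ * (κ + 1) * ρ / Φ ^ 2 + 2 * N * κ / Φ)) :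
    2 / N * ((Φ / R) ^ 2 * z + (Φ / R) ^ 2 * S) ^ 2
      ≤ 2 * κ * (2 * ((Φ / R) ^ 2 * z) + q * ((Φ / R) ^ 2 * S)) * √((Φ / R) ^ 2 * z)
        + 2 * m * ((Φ / R) ^ 2 * z) * ((Φ / R) ^ 2 * S)
        + (4 * κ * (κ + 1) + 2 * N * κ) * ((Φ / R) ^ 2 * z) := by
  obtain ⟨a, ha⟩ : ∃ a, a = Φ / R := ⟨_, rfl⟩
  have ha0 : 0 < a := ha ▸ div_pos hΦ hR
  have hΦa : Φ = a * R := by rw [ha]; field_simp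
  rw [← ha, Real.sqrt_mul (sq_nonneg a), Real.sqrt_sq ha0.le]
  have hρR : √ρ ≤ R := by
    rw [show R = √(R ^ 2) from (Real.sqrt_sq hR.le).symm]
    exact Real.sqrt_le_sqrt (by linarith)
  have ht' : t ≤ √z * R := ht.trans (by gcongr)
  have e1 : a ^ 4 * (2 * ((z + S) ^ 2 / N)) = 2 / N * (a ^ 2 * z + a ^ 2 * S) ^ 2 := by
    field_simp
  have e2 : a ^ 4 * (z * (4 * κ * (κ + 1) * ρ / Φ ^ 2 + 2 * N * κ / Φ))
      ≤ (4 * κ * (κ + 1) + 2 * N * κ) * (a ^ 2 * z) := by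
    have h1 : ρ / Φ ^ 2 ≤ 1 / a ^ 2 := by
      rw [hΦa, div_le_div_iff₀ (by positivity) (by positivity)]
      nlinarith [sq_nonneg a]
    have h2 : 1 / Φ ≤ 1 / a ^ 2 := by
      rw [div_le_div_iff₀ (by positivity) (by positivity)]
      have : a ≤ R := by rw [ha, div_le_iff₀ hR]; nlinarith
      rw [hΦa]; nlinarith
    calc a ^ 4 * (z * (4 * κ * (κ + 1) * ρ / Φ ^ 2 + 2 * N * κ / Φ))
        = a ^ 4 * (z * (4 * κ * (κ + 1) * (ρ / Φ ^ 2) + 2 * N * κ * (1 / Φ))) := by ring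
      _ ≤ a ^ 4 * (z * (4 * κ * (κ + 1) * (1 / a ^ 2) + 2 * N * κ * (1 / a ^ 2))) := by gcongr
      _ = _ := by field_simp
  have e3 : a ^ 4 * ((1 + q / 2 * (S / z)) * (2 * κ * z / Φ * t))
      ≤ κ * (2 * (a ^ 2 * z) + q * (a ^ 2 * S)) * (a * √z) := by
    calc a ^ 4 * ((1 + q / 2 * (S / z)) * (2 * κ * z / Φ * t))
        ≤ a ^ 4 * ((1 + q / 2 * (S / z)) * (2 * κ * z / Φ * (√z * R))) := by gcongr
      _ = _ := by rw [hΦa]; field_simp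
  have := mul_le_mul_of_nonneg_left hB (by positivity : 0 ≤ a ^ 4)
  nlinarith

/-- Bernstein's estimate at a maximum point of the localised squared gradient. -/
lemma exists_bernstein (hn : 0 < n) {w : E → ℝ} (hw : ContDiff ℝ 2 w) {c m q κ R : ℝ} (hc : 0 ≤ c)
    (hq : 0 ≤ q) (hκ : 0 < κ) (hR : 0 < R) {y₀ : E} (hy₀ : 0 < gradSq w y₀)
    (heq : ∀ y, elaplacian w y = -gradSq w y - c * (gradSq w y ^ (q / 2) * exp (m * w y))) :
    ∃ x : E, ∃ a : ℝ, 0 < a ∧ a ≤ R ∧ ‖x - y₀‖ < R ∧ R ^ κ * gradSq w y₀ ≤ a ^ κ * gradSq w x ∧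
      ∀ X Y, X = a ^ 2 * gradSq w x → Y = a ^ 2 * (c * (gradSq w x ^ (q / 2) * exp (m * w x))) →
        2 / n * (X + Y) ^ 2 ≤ 2 * κ * (2 * X + q * Y) * √X + 2 * m * X * Y
          + (4 * κ * (κ + 1) + 2 * n * κ) * X := by
  have cz : Continuous (gradSq w) := hw.gradSq.continuous
  have ccap : Continuous (cap y₀ R) := (contDiff_cap (k := 1) y₀ R).continuous
  obtain ⟨x, hxB, hmax⟩ := (isCompact_closedBall y₀ R).exists_isMaxOn
    (Metric.nonempty_closedBall.2 hR.le)
    ((ccap.rpow_const fun _ => Or.inr hκ.le).mul cz).continuousOn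
  have hmax' (y : E) (hy : ‖y - y₀‖ ≤ R) :
      cap y₀ R y ^ κ * gradSq w y ≤ cap y₀ R x ^ κ * gradSq w x :=
    hmax (by simpa [dist_eq_norm] using hy)
  have hcap0 : cap y₀ R y₀ = R ^ 2 := by simp [cap_eq]
  have h0 := hmax' y₀ (by simpa using hR.le)
  rw [hcap0] at h0
  have hpos : 0 < cap y₀ R x ^ κ * gradSq w x := lt_of_lt_of_le (by positivity) h0
  have hcapnn : 0 ≤ cap y₀ R x := by
    rw [mem_closedBall_iff_norm] at hxB
    rw [cap_eq]
    nlinarith [norm_nonneg (x - y₀)]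
  have hΦ : 0 < cap y₀ R x := by
    refine hcapnn.lt_of_ne' fun h => ?_
    rw [h, zero_rpow hκ.ne'] at hpos
    simp at hpos
  have hz : 0 < gradSq w x := by
    refine (gradSq_nonneg w x).lt_of_ne' fun h => ?_
    rw [h] at hpos
    simp at hpos
  have hev : ∀ᶠ y in 𝓝 x, 0 < cap y₀ R y := ccap.continuousAt.eventually_const_lt hΦ
  have hcapR (y : E) (hy : 0 < cap y₀ R y) : ‖y - y₀‖ < R := by
    rw [cap_eq] at hy
    nlinarith [norm_nonneg (y - y₀)]
  set K := cap y₀ R x ^ κ * gradSq w x with hK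
  set Ψ : E → ℝ := fun y => K * cap y₀ R y ^ (-κ) with hΨ
  have hΨx : gradSq w x = Ψ x := by
    simp only [hΨ, hK]
    rw [rpow_neg hΦ.le]
    field_simp
  have hle : ∀ᶠ y in 𝓝 x, gradSq w y ≤ Ψ y := by
    filter_upwards [hev] with y hy
    have := hmax' y (hcapR y hy).le
    simp only [hΨ]
    rw [rpow_neg hy.le, ← div_eq_mul_inv, le_div_iff₀ (by positivity)]
    linarith
  have hΨc : ContDiffAt ℝ 2 Ψ x :=
    contDiffAt_const.mul (((contDiff_cap y₀ R).contDiffAt).rpow_const_of_ne hΦ.ne')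
  have hzc : ContDiffAt ℝ 1 (gradSq w) x := hw.gradSq.contDiffAt
  have hzd : DifferentiableAt ℝ (gradSq w) x := hzc.differentiableAt (by simp)
  have hwd : DifferentiableAt ℝ w x := hw.contDiffAt.differentiableAt (by simp)
  have hel : elaplacian w
      = fun y => -gradSq w y - c * (gradSq w y ^ (q / 2) * exp (m * w y)) := funext heq
  have hΔ : ContDiffAt ℝ 1 (elaplacian w) x := by
    rw [hel]
    exact hzc.neg.sub (contDiffAt_const.mul ((hzc.rpow_const_of_ne hz.ne').mul
      (contDiffAt_const.mul (hw.of_le one_le_two).contDiffAt).exp))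
  have hgrad (i : Fin n) : pd i (gradSq w) x = 2 * κ * gradSq w x / cap y₀ R x * (x i - y₀ i) := by
    have hl : IsLocalMax (fun y => gradSq w y - Ψ y) x := by
      change ∀ᶠ y in 𝓝 x, _ ≤ _
      filter_upwards [hle] with y hy
      linarith
    have h1 : pd i (fun y => gradSq w y - Ψ y) x = 0 := by simp [pd, hl.fderiv_eq_zero]
    rw [pd_sub i hzd (hΨc.differentiableAt (by simp))] at h1
    rw [sub_eq_zero.1 h1, hΨx, hΨ, pd_cap_rpow i hΦ, rpow_sub_one hΦ.ne']
    ring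
  have key := bochner_le_of_touching hn hw hΔ hΨc hle hΨx
  set S := c * (gradSq w x ^ (q / 2) * exp (m * w x)) with hS
  have hS0 : 0 ≤ S := by positivity
  have hgL (i : Fin n) : pd i (elaplacian w) x
      = -(1 + q / 2 * (S / gradSq w x)) * pd i (gradSq w) x - m * S * pd i w x := by
    have hd1 : DifferentiableAt ℝ (fun y => gradSq w y ^ (q / 2)) x :=
      hzd.rpow_const (Or.inl hz.ne')
    have hd2 : DifferentiableAt ℝ (fun y => exp (m * w y)) x := (hwd.const_mul m).exp
    rw [hel, pd_sub i hzd.fun_neg ((hd1.fun_mul hd2).const_mul c),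
      pd_const_mul i c (hd1.fun_mul hd2), pd_mul i hd1 hd2,
      pd_comp i (ρ := fun t => t ^ (q / 2)) (Real.hasDerivAt_rpow_const (Or.inl hz.ne')) hzd,
      pd_comp i (ρ := exp) (Real.hasDerivAt_exp _) (hwd.const_mul m), pd_const_mul i m hwd,
      rpow_sub_one hz.ne', hS]
    have : pd i (fun y => -gradSq w y) x = -pd i (gradSq w) x := by simp [pd, fderiv_fun_neg]
    rw [this]
    field_simp
    ring
  have hNn : (0 : ℝ) < n := by exact_mod_cast hn
  have hsq := sq_elaplacian_le w x
  rw [heq x] at hsq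
  refine ⟨x, cap y₀ R x / R, by positivity, ?_, hcapR x hΦ, ?_, ?_⟩
  · rw [div_le_iff₀ hR, cap_eq]
    nlinarith [sq_nonneg ‖x - y₀‖]
  · rw [div_rpow hΦ.le hR.le, div_mul_eq_mul_div, le_div_iff₀ (by positivity)]
    refine le_of_eq_of_le ?_ h0
    rw [← rpow_natCast R 2, ← rpow_mul hR.le]
    rw [mul_right_comm, ← rpow_add hR]
    congr 2
    push_cast
    ring
  · rintro X Y rfl rfl
    refine bernstein_arith (t := ∑ i, pd i w x * (x i - y₀ i)) (ρ := ∑ i, (x i - y₀ i) ^ 2) hz hS0 hΦ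
      hR hκ hq hNn rfl (Finset.sum_nonneg fun _ _ => sq_nonneg _)
      (Real.sum_mul_le_sqrt_mul_sqrt _ _ _) ?_
    rw [hΨ, elaplacian_cap_rpow hΦ, ← show gradSq w x = K * cap y₀ R x ^ (-κ) from hΨx] at key
    refine le_trans (add_le_add ?_ ?_) key
    · simp only [hgL, hgrad]
      have hsum (α β γ : ℝ) : ∑ i, pd i w x * (-α * (β * (x i - y₀ i)) - γ * pd i w x)
          = -α * (β * ∑ i, pd i w x * (x i - y₀ i)) - γ * gradSq w x := by
        rw [gradSq, Finset.mul_sum, Finset.mul_sum, Finset.mul_sum, ← Finset.sum_sub_distrib]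
        exact Finset.sum_congr rfl fun i _ => by ring
      rw [hsum]
    · gcongr
      rw [div_le_iff₀ hNn]
      nlinarith

end Bernstein

section BernsteinConsequences

variable {n : ℕ}

local notation "E" => EuclideanSpace ℝ (Fin n)

lemma elaplacian_add {f g : E → ℝ} (hf : ContDiff ℝ 2 f) (hg : ContDiff ℝ 2 g) (x : E) :
    elaplacian (fun y => f y + g y) x = elaplacian f x + elaplacian g x := by
  have h1 (i : Fin n) : pd i (fun y => f y + g y) = fun y => pd i f y + pd i g y :=
    funext fun y => pd_add i (hf.differentiable (by simp) y) (hg.differentiable (by simp) y)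
  simp only [elaplacian_eq, h1, ← Finset.sum_add_distrib]
  exact Finset.sum_congr rfl fun i _ => pd_add i ((hf.pd_one i).differentiable (by simp) x)
    ((hg.pd_one i).differentiable (by simp) x)

lemma elaplacian_const_mul {f : E → ℝ} (hf : ContDiff ℝ 2 f) (c : ℝ) (x : E) :
    elaplacian (fun y => c * f y) x = c * elaplacian f x := by
  have h1 (i : Fin n) : pd i (fun y => c * f y) = fun y => c * pd i f y :=
    funext fun y => pd_const_mul i c (hf.differentiable (by simp) y)
  simp only [elaplacian_eq, h1, Finset.mul_sum]
  exact Finset.sum_congr rfl fun i _ => pd_const_mul i c ((hf.pd_one i).differentiable (by simp) x)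

lemma elaplacian_cap (a : E) (R : ℝ) (x : E) : elaplacian (cap a R) x = -(2 * n) := by
  have h1 (i : Fin n) : pd i (pd i (cap a R)) x = -2 := by
    rw [funext (pd_cap a R i), pd_const_mul i _ (by fun_prop), pd_sub i (by fun_prop) (by fun_prop),
      pd_coord]
    simp [pd]
  rw [elaplacian_eq]
  simp only [h1, Finset.sum_const, Finset.card_univ, Fintype.card_fin, nsmul_eq_mul]
  ring

lemma abs_sub_le_of_gradSq_le {w : E → ℝ} (hw : ContDiff ℝ 2 w) {x y₀ : E} {r : ℝ}
    (hz : ∀ y, ‖y - y₀‖ ≤ r → gradSq w y ≤ 4) (hx : ‖x - y₀‖ ≤ r) :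
    |w x - w y₀| ≤ 2 * ‖x - y₀‖ := by
  refine (convex_closedBall y₀ r).norm_image_sub_le_of_norm_fderiv_le (𝕜 := ℝ)
    (fun y _ => hw.differentiable (by simp) y) (fun y hy => ?_)
    (Metric.mem_closedBall_self ((norm_nonneg _).trans hx)) (by simpa [dist_eq_norm] using hx)
  have := hz y (by simpa [dist_eq_norm] using hy)
  rw [gradSq_eq] at this
  nlinarith [norm_nonneg (fderiv ℝ w y)]

/-- Entire solutions have no gradient when the source is absent or non-increasing. -/
lemma gradSq_eq_zero (hn : 0 < n) {w : E → ℝ} (hw : ContDiff ℝ 2 w) {c m q : ℝ} (hc : 0 ≤ c)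
    (hq : 0 ≤ q)
    (heq : ∀ y, elaplacian w y = -gradSq w y - c * (gradSq w y ^ (q / 2) * exp (m * w y)))
    (hcm : c = 0 ∨ m ≤ 0) (y : E) : gradSq w y = 0 := by
  by_contra hne
  have hz : 0 < gradSq w y := (gradSq_nonneg w y).lt_of_ne' hne
  have hNn : (0 : ℝ) < n := by exact_mod_cast hn
  set C : ℝ := n / 2 * (4 * (2 + q) + (24 + 4 * n)) with hC
  have hC0 : 0 < C := by positivity
  obtain ⟨x, a, ha, -, -, h1, h2⟩ := exists_bernstein hn hw hc hq two_pos
    (R := (C + 1) / √(gradSq w y)) (by positivity) hz heq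
  set X := a ^ 2 * gradSq w x with hX
  set Y := a ^ 2 * (c * (gradSq w x ^ (q / 2) * exp (m * w x))) with hY
  have hXlow : (C + 1) ^ 2 ≤ X := by
    rw [rpow_two, rpow_two, div_pow, Real.sq_sqrt hz.le, div_mul_cancel₀ _ hz.ne'] at h1
    exact h1
  have hX0 : 0 < X := by nlinarith
  have hY0 : 0 ≤ Y := by have := gradSq_nonneg w x; positivity
  have hmXY : m * X * Y ≤ 0 := by
    rcases hcm with h | h
    · simp [hY, h]
    · exact mul_nonpos_of_nonpos_of_nonneg (mul_nonpos_of_nonpos_of_nonneg h hX0.le) hY0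
  have h3 := h2 X Y rfl rfl
  set s := √X with hs
  have hsX : X = s ^ 2 := (Real.sq_sqrt hX0.le).symm
  have hsC : C + 1 ≤ s := Real.le_sqrt_of_sq_le hXlow
  have hT : X ≤ X + Y := by linarith
  have h4 : 2 / n * (X + Y) ^ 2 ≤ (4 * (2 + q) + (24 + 4 * n)) * s * (X + Y) := by
    refine h3.trans ?_
    have e1 : q * X * s ≥ 0 := by positivity
    have e2 : Y * s ≥ 0 := by positivity
    have e3 : (24 + 4 * n) * X ≤ (24 + 4 * n) * s * (X + Y) := by
      rw [mul_assoc]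
      gcongr
      nlinarith
    nlinarith
  have h5 : 2 / n * (X + Y) ≤ (4 * (2 + q) + (24 + 4 * n)) * s :=
    le_of_mul_le_mul_right (by linarith) (hX0.trans_le hT)
  have h6 : X + Y ≤ C * s := by
    rw [div_mul_eq_mul_div, div_le_iff₀ hNn] at h5
    rw [hC]
    linarith
  nlinarith

/-- A pointwise bound on the source term when the gradient is bounded on a unit ball. -/
lemma exists_source_le (hn : 0 < n) (m : ℝ) {q : ℝ} (hq : 0 ≤ q) :
    ∃ C : ℝ, ∀ (w : E → ℝ) (c : ℝ) (y₀ : E), ContDiff ℝ 2 w → 0 ≤ c →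
      (∀ y, elaplacian w y = -gradSq w y - c * (gradSq w y ^ (q / 2) * exp (m * w y))) →
      (∀ y, ‖y - y₀‖ ≤ 1 → gradSq w y ≤ 4) →
      c * (gradSq w y₀ ^ (q / 2) * exp (m * w y₀)) ≤ C := by
  have hNn : (0 : ℝ) < n := by exact_mod_cast hn
  have hexp {w : E → ℝ} {x y₀ : E} (hw : ContDiff ℝ 2 w)
      (hz : ∀ y, ‖y - y₀‖ ≤ 1 → gradSq w y ≤ 4) (hx : ‖x - y₀‖ ≤ 1) :
      exp (m * w y₀) ≤ exp (2 * |m|) * exp (m * w x) := by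
    rw [← exp_add, exp_le_exp]
    have h1 := abs_sub_le_of_gradSq_le hw hz hx
    have h2 : -(m * (w x - w y₀)) ≤ |m| * |w x - w y₀| := by
      rw [← abs_mul]
      exact neg_le_abs _
    have : |m| * |w x - w y₀| ≤ |m| * 2 := by gcongr; linarith
    linarith
  rcases hq.eq_or_lt with rfl | hq0
  · refine ⟨exp (2 * |m|) * (8 * n), fun w c y₀ hw hc heq hz => ?_⟩
    simp only [zero_div, rpow_zero, one_mul] at heq ⊢
    by_contra! hlt
    set σ := c * exp (m * w y₀) / exp (2 * |m|) with hσ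
    have hσ8 : 8 * n < σ := by
      rw [hσ, lt_div_iff₀ (exp_pos _)]
      linarith
    have hσ0 : 0 < σ := by linarith
    set β := σ / (4 * n) with hβ
    have hβ2 : 2 < β := by
      rw [hβ, lt_div_iff₀ (by positivity)]
      linarith
    have hψ : ContDiff ℝ 2 fun y => (-1) * w y + β * cap y₀ 1 y :=
      (contDiff_const.mul hw).add (contDiff_const.mul (contDiff_cap y₀ 1))
    obtain ⟨x, hxB, hmax⟩ := (isCompact_closedBall y₀ 1).exists_isMaxOn
      (Metric.nonempty_closedBall.2 zero_le_one) hψ.continuous.continuousOn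
    rw [mem_closedBall_iff_norm] at hxB
    have h0 : (-1) * w y₀ + β * cap y₀ 1 y₀ ≤ (-1) * w x + β * cap y₀ 1 x :=
      hmax (Metric.mem_closedBall_self zero_le_one)
    have hL := abs_sub_le_of_gradSq_le hw hz hxB
    rw [cap_eq, cap_eq] at h0
    rcases hxB.lt_or_eq with hlt' | heq'
    · have hlm : IsLocalMax (fun y => (-1) * w y + β * cap y₀ 1 y) x :=
        hmax.isLocalMax (Metric.closedBall_mem_nhds_of_mem (by simpa [dist_eq_norm] using hlt'))
      have h1 := elaplacian_nonpos_of_isLocalMax hn hψ hlm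
      rw [elaplacian_add (contDiff_const.mul hw) (contDiff_const.mul (contDiff_cap y₀ 1)),
        elaplacian_const_mul hw, elaplacian_const_mul (contDiff_cap y₀ 1), elaplacian_cap,
        heq] at h1
      have h2 : σ ≤ c * exp (m * w x) := by
        rw [hσ, div_le_iff₀ (exp_pos _), mul_assoc, mul_comm (exp (m * w x))]
        gcongr
        exact hexp hw hz hxB
      have h3 : β * (2 * n) = σ / 2 := by
        rw [hβ]
        field_simp
        norm_num
      have := gradSq_nonneg w x
      linarith
    · rw [heq'] at h0 hL
      simp only [sub_self, norm_zero] at h0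
      have := neg_le_abs (w x - w y₀)
      linarith
  · set κ := 4 / q with hκ
    have hκ0 : 0 < κ := by positivity
    set α := n / 2 * (4 * κ * q + 8 * |m|) with hα
    set β := n / 2 * (32 * κ + (4 * κ * (κ + 1) + 2 * n * κ) * 4) with hβ
    have hα0 : 0 ≤ α := by positivity
    have hβ0 : 0 ≤ β := by positivity
    refine ⟨exp (2 * |m|) * (α + β + 1), fun w c y₀ hw hc heq hz => ?_⟩
    rcases (gradSq_nonneg w y₀).eq_or_lt with h0 | hz0
    · rw [← h0, zero_rpow (by positivity)]
      simp only [zero_mul, mul_zero]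
      positivity
    obtain ⟨x, a, ha, ha1, hx, h1, h2⟩ := exists_bernstein hn hw hc hq hκ0 one_pos hz0 heq
    have hzx := hz x hx.le
    have hzx0 := gradSq_nonneg w x
    set X := a ^ 2 * gradSq w x with hX
    set Y := a ^ 2 * (c * (gradSq w x ^ (q / 2) * exp (m * w x))) with hY
    have hX0 : 0 ≤ X := by positivity
    have hY0 : 0 ≤ Y := by positivity
    have hX4 : X ≤ 4 := by nlinarith
    have hY' : Y ≤ α + β + 1 := by
      have h3 := h2 X Y rfl rfl
      have hs : √X ≤ 2 := Real.sqrt_le_iff.2 ⟨by norm_num, by linarith⟩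
      have h4 : 2 / n * Y ^ 2 ≤ 2 * κ * (2 * 4 + q * Y) * 2 + 2 * |m| * 4 * Y
          + (4 * κ * (κ + 1) + 2 * n * κ) * 4 := by
        calc 2 / n * Y ^ 2 ≤ 2 / n * (X + Y) ^ 2 := by gcongr; linarith
          _ ≤ _ := h3
          _ ≤ _ := by
            gcongr
            exact le_abs_self m
      have h5 : Y ^ 2 ≤ α * Y + β := by
        rw [div_mul_eq_mul_div, div_le_iff₀ hNn] at h4
        rw [hα, hβ]
        linarith
      by_contra! hlt
      nlinarith
    refine le_trans ?_ (mul_le_mul_of_nonneg_left hY' (exp_pos _).le)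
    have h6 : gradSq w y₀ ^ (q / 2) ≤ a ^ 2 * gradSq w x ^ (q / 2) := by
      rw [one_rpow, one_mul] at h1
      have h7 := rpow_le_rpow hz0.le h1 (by positivity : 0 ≤ q / 2)
      rwa [mul_rpow (by positivity) hzx0, ← rpow_mul ha.le,
        show κ * (q / 2) = (2 : ℕ) by rw [hκ]; field_simp; norm_num, rpow_natCast] at h7
    calc c * (gradSq w y₀ ^ (q / 2) * exp (m * w y₀))
        ≤ c * (a ^ 2 * gradSq w x ^ (q / 2) * (exp (2 * |m|) * exp (m * w x))) := by
          gcongr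
          exact hexp hw hz hx.le
      _ = _ := by rw [hY]; ring

end BernsteinConsequences

section Schauder

variable {n : ℕ} {ι : Type*} {l : Filter ι}

local notation "E" => EuclideanSpace ℝ (Fin n)

/-- Eventual uniform boundedness of a family on a ball around the origin. -/
def UnifBdd (l : Filter ι) (g : ι → E → ℝ) (R : ℝ) : Prop :=
  ∃ M, ∀ᶠ k in l, ∀ x, ‖x‖ ≤ R → |g k x| ≤ M

/-- Eventual uniform Hölder continuity of a family on a ball around the origin. -/
def UnifHolder (l : Filter ι) (g : ι → E → ℝ) (R : ℝ) : Prop :=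
  ∃ M δ : ℝ, 0 ≤ M ∧ 0 < δ ∧ δ ≤ 1 ∧ ∀ᶠ k in l, ∀ x y, ‖x‖ ≤ R → ‖y‖ ≤ R → ‖x - y‖ ≤ 1 →
    |g k x - g k y| ≤ M * ‖x - y‖ ^ δ

lemma UnifBdd.exists_nonneg {g : ι → E → ℝ} {R : ℝ} (h : UnifBdd l g R) :
    ∃ M, 0 ≤ M ∧ ∀ᶠ k in l, ∀ x, ‖x‖ ≤ R → |g k x| ≤ M := by
  obtain ⟨M, hM⟩ := h
  exact ⟨max M 0, le_max_right _ _, hM.mono fun k hk x hx => (hk x hx).trans (le_max_left _ _)⟩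

lemma abs_sub_le_of_deriv_rpow {f D : ℝ → ℝ} {M β : ℝ} (hβ : 0 < β) (hf : Continuous f)
    (hD : ∀ s, 0 < s → s ≤ 1 → HasDerivAt f (D s) s ∧ |D s| ≤ M * s ^ (β - 1)) {s : ℝ} (hs : 0 < s)
    (hs1 : s ≤ 1) : |f s - f 0| ≤ M / β * s ^ β := by
  have hp (t : ℝ) (ht : 0 < t) : HasDerivAt (fun t => M / β * t ^ β) (M * t ^ (β - 1)) t := by
    refine ((Real.hasDerivAt_rpow_const (Or.inl ht.ne')).const_mul (M / β)).congr_deriv ?_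
    field_simp
  have hpc : Continuous fun t : ℝ => M / β * t ^ β :=
    continuous_const.mul (continuous_id.rpow_const fun _ => Or.inr hβ.le)
  have h1 : MonotoneOn (fun t => f t + M / β * t ^ β) (Icc 0 s) := by
    refine monotoneOn_of_deriv_nonneg (convex_Icc _ _) (hf.add hpc).continuousOn
      (fun t ht => ?_) fun t ht => ?_ <;> rw [interior_Icc] at ht
    · exact ((hD t ht.1 (ht.2.le.trans hs1)).1.fun_add
        (hp t ht.1)).differentiableAt.differentiableWithinAt
    · rw [((hD t ht.1 (ht.2.le.trans hs1)).1.fun_add (hp t ht.1)).deriv]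
      linarith [(abs_le.1 (hD t ht.1 (ht.2.le.trans hs1)).2).1]
  have h2 : AntitoneOn (fun t => f t - M / β * t ^ β) (Icc 0 s) := by
    refine antitoneOn_of_deriv_nonpos (convex_Icc _ _) (hf.sub hpc).continuousOn
      (fun t ht => ?_) fun t ht => ?_ <;> rw [interior_Icc] at ht
    · exact ((hD t ht.1 (ht.2.le.trans hs1)).1.fun_sub
        (hp t ht.1)).differentiableAt.differentiableWithinAt
    · rw [((hD t ht.1 (ht.2.le.trans hs1)).1.fun_sub (hp t ht.1)).deriv]
      linarith [(abs_le.1 (hD t ht.1 (ht.2.le.trans hs1)).2).2]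
  have m1 := h1 (left_mem_Icc.2 hs.le) (right_mem_Icc.2 hs.le) hs.le
  have m2 := h2 (left_mem_Icc.2 hs.le) (right_mem_Icc.2 hs.le) hs.le
  simp only [zero_rpow hβ.ne', mul_zero, add_zero, sub_zero] at m1 m2
  rw [abs_le]
  constructor <;> linarith

lemma avg_sub {φ g h : E → ℝ} (hφ : IsTest φ) (hg : Continuous g) (hh : Continuous h)
    (x y : E) (s : ℝ) : avg φ g x s - avg φ h y s = ∫ z, (g (x + s • z) - h (y + s • z)) * φ z := by
  simp only [avg, sub_mul]
  exact (integral_sub (integrable_avg hφ hg x s) (integrable_avg hφ hh y s)).symm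

lemma abs_avg_sub_avg_le {φ g : E → ℝ} (hφ : IsTest φ) (hg : Continuous g) {x y : E} {s M : ℝ}
    (hM : ∀ z, ‖z‖ ≤ 1 → |g (x + s • z) - g (y + s • z)| ≤ M) :
    |avg φ g x s - avg φ g y s| ≤ M * ∫ z, ‖φ z‖ := by
  have := abs_avg_le hφ (g := fun z => g (x + z) - g (y + z)) (x := 0) (s := s) (M := M)
    (by simpa using hM)
  rw [avg_sub hφ hg hg]
  simpa [avg] using this

lemma norm_add_smul_le {x z : E} {R s : ℝ} (hx : ‖x‖ ≤ R) (hs : 0 ≤ s) (hs1 : s ≤ 1)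
    (hz : ‖z‖ ≤ 1) : ‖x + s • z‖ ≤ R + 1 := by
  refine (norm_add_le _ _).trans (add_le_add hx ?_)
  rw [norm_smul, Real.norm_eq_abs, abs_of_nonneg hs]
  exact mul_le_one₀ hs1 (norm_nonneg _) hz

/-- Hölder continuity of a partial derivative from control of its averages. -/
lemma holder_of_avg {ζ h : E → ℝ} (hζ : IsTest ζ) (hζ0 : 0 < ∫ y, ζ y) (hh : ContDiff ℝ 1 h)
    (i : Fin n) {R M β γ : ℝ} (hM : 0 ≤ M) (hβ : 0 < β) (hβ1 : β ≤ 1) (hγ : 0 < γ)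
    (hD : ∀ x, ‖x‖ ≤ R → ∃ D : ℝ → ℝ, ∀ s, 0 < s → s ≤ 1 →
      HasDerivAt (avg ζ (pd i h) x) (D s) s ∧ |D s| ≤ M * s ^ (β - 1))
    (hL : ∀ x y, ‖x‖ ≤ R + 1 → ‖y‖ ≤ R + 1 → ‖x - y‖ ≤ 1 → |h x - h y| ≤ M * ‖x - y‖ ^ γ)
    {x y : E} (hx : ‖x‖ ≤ R) (hy : ‖y‖ ≤ R) (hxy : ‖x - y‖ ≤ 1) :
    |pd i h x - pd i h y|
      ≤ (2 / β + ∫ y, ‖pd i ζ y‖) / (∫ y, ζ y) * M * ‖x - y‖ ^ (β * γ / 2) := by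
  rcases (norm_nonneg (x - y)).eq_or_lt with h0 | h0
  · have : x = y := sub_eq_zero.1 (norm_eq_zero.1 h0.symm)
    subst this
    simp only [sub_self, abs_zero]
    positivity
  set d := ‖x - y‖ with hd
  set s := d ^ (γ / 2) with hs
  have hs0 : 0 < s := rpow_pos_of_pos h0 _
  have hs1 : s ≤ 1 := rpow_le_one h0.le hxy (by positivity)
  have hc := hh.continuous_pd i
  have key (x : E) (hx : ‖x‖ ≤ R) :
      |avg ζ (pd i h) x s - (∫ y, ζ y) * pd i h x| ≤ M / β * s ^ β := by
    obtain ⟨D, hDx⟩ := hD x hx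
    have := abs_sub_le_of_deriv_rpow hβ (continuous_avg hζ hc x) hDx hs0 hs1
    rwa [avg_zero] at this
  have h2 : s * |avg ζ (pd i h) x s - avg ζ (pd i h) y s| ≤ M * d ^ γ * ∫ y, ‖pd i ζ y‖ := by
    rw [← abs_of_pos hs0, ← abs_mul, abs_of_pos hs0, mul_sub, mul_avg_pd hζ hh, mul_avg_pd hζ hh,
      neg_sub_neg, abs_sub_comm]
    refine abs_avg_sub_avg_le (hζ.pd i) hh.continuous fun z hz => ?_
    have := hL _ _ (norm_add_smul_le hx hs0.le hs1 hz) (norm_add_smul_le hy hs0.le hs1 hz)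
      (by simpa using hxy)
    simpa using this
  have hdγ : d ^ γ = s * s := by
    rw [hs, ← rpow_add h0]
    congr 1
    ring
  have hsβ : s ^ β = d ^ (β * γ / 2) := by
    rw [hs, ← rpow_mul h0.le]
    congr 1
    ring
  have hss : s ≤ s ^ β := by
    conv_lhs => rw [← rpow_one s]
    exact rpow_le_rpow_of_exponent_ge hs0 hs1 hβ1
  have hI : 0 ≤ ∫ y, ‖pd i ζ y‖ := integral_nonneg fun _ => norm_nonneg _
  have h3 : |avg ζ (pd i h) x s - avg ζ (pd i h) y s| ≤ M * s ^ β * ∫ y, ‖pd i ζ y‖ := by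
    refine le_trans (le_of_mul_le_mul_left ?_ hs0) (by gcongr : M * s * _ ≤ _)
    rw [hdγ] at h2
    linarith
  have h4 : (∫ y, ζ y) * |pd i h x - pd i h y| ≤ (2 / β + ∫ y, ‖pd i ζ y‖) * M * s ^ β := by
    have e : (∫ y, ζ y) * |pd i h x - pd i h y| = |(∫ y, ζ y) * (pd i h x - pd i h y)| := by
      rw [abs_mul, abs_of_pos hζ0]
    rw [e, mul_sub]
    have k1 := abs_le.1 (key x hx)
    have k2 := abs_le.1 (key y hy)
    have k3 := abs_le.1 h3
    have : (2 / β + ∫ y, ‖pd i ζ y‖) * M * s ^ β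
      = M / β * s ^ β + M / β * s ^ β + M * s ^ β * ∫ y, ‖pd i ζ y‖ := by ring
    rw [this, abs_le]
    constructor <;> linarith [k1.1, k1.2, k2.1, k2.2, k3.1, k3.2]
  rw [← hsβ, div_mul_eq_mul_div, div_mul_eq_mul_div, le_div_iff₀ hζ0]
  linarith

/-- Uniform Hölder continuity of the gradient. -/
lemma unifHolder_pd (hn : 0 < n) {u : ι → E → ℝ} (hu : ∀ k, ContDiff ℝ 2 (u k)) {R : ℝ}
    (h1 : UnifBdd l (fun k x => ‖fderiv ℝ (u k) x‖) (R + 1))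
    (h2 : UnifBdd l (fun k => elaplacian (u k)) (R + 1)) (i : Fin n) :
    UnifHolder l (fun k => pd i (u k)) R := by
  obtain ⟨Θ, ζ, hk⟩ := exists_isKernelPair hn
  obtain ⟨M₁, hM₁, h1⟩ := h1.exists_nonneg
  obtain ⟨M₂, hM₂, h2⟩ := h2.exists_nonneg
  have hI : 0 ≤ ∫ y, ‖pd i Θ y‖ := integral_nonneg fun _ => norm_nonneg _
  have hI' : 0 ≤ ∫ y, ‖pd i ζ y‖ := integral_nonneg fun _ => norm_nonneg _
  have hζ0 := hk.integralζ
  refine ⟨(2 / 1 + ∫ y, ‖pd i ζ y‖) / (∫ y, ζ y) * (M₁ + M₂ * ∫ y, ‖pd i Θ y‖), 1 * 1 / 2,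
    by positivity, by norm_num, by norm_num, ?_⟩
  filter_upwards [h1, h2] with k hk1 hk2 x y hx hy hxy
  refine holder_of_avg (M := M₁ + M₂ * ∫ y, ‖pd i Θ y‖) (β := 1) (γ := 1) hk.testζ hk.integralζ
    ((hu k).of_le one_le_two) i (by positivity) one_pos le_rfl one_pos (fun x hx => ?_)
    (fun x y hx hy _ => ?_) hx hy hxy
  · refine ⟨_, fun s hs hs1 => ⟨hk.hasDerivAt_avg_pd (hu k) i x hs.ne', ?_⟩⟩
    rw [sub_self, rpow_zero, mul_one, abs_neg]
    refine (abs_avg_le (hk.testΘ.pd i) fun z hz =>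
      hk2 _ (norm_add_smul_le hx hs.le hs1 hz)).trans ?_
    linarith
  · rw [rpow_one]
    refine ((convex_closedBall (0 : E) (R + 1)).norm_image_sub_le_of_norm_fderiv_le (𝕜 := ℝ)
      (C := M₁) (fun y _ => (hu k).differentiable (by simp) y)
      (fun z hz => ?_) (by simpa using hy) (by simpa using hx)).trans ?_
    · simpa using hk1 z (by simpa using hz)
    · gcongr
      linarith [mul_nonneg hM₂ hI]

lemma abs_avg_pd_pd_le {Θ f : E → ℝ} (hΘ : IsTest Θ) (hf : Continuous f) (i j : Fin n) {x : E}
    {s M : ℝ} (hM : ∀ z, ‖z‖ ≤ 1 → |f (x + s • z) - f x| ≤ M) :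
    |avg (pd j (pd i Θ)) f x s| ≤ M * ∫ y, ‖pd j (pd i Θ) y‖ := by
  have h0 : ∫ y, pd j (pd i Θ) y = 0 := by
    have := mul_avg_pd (hΘ.pd i) (g := fun _ : E => (1 : ℝ)) contDiff_const j 0 1
    have hz : pd j (fun _ : E => (1 : ℝ)) = fun _ => 0 := by ext; simp [pd]
    rw [hz] at this
    simpa [avg] using this
  have h1 := abs_avg_le ((hΘ.pd i).pd j) (g := fun y => f y - f x) hM
  have h2 : avg (pd j (pd i Θ)) (fun y => f y - f x) x s = avg (pd j (pd i Θ)) f x s := by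
    have := avg_sub ((hΘ.pd i).pd j) hf (continuous_const (y := f x)) x x s
    rw [show avg (pd j (pd i Θ)) (fun _ => f x) x s = 0 by
      rw [avg, integral_const_mul, h0, mul_zero], sub_zero] at this
    rw [this]
    rfl
  rwa [h2] at h1

lemma IsKernelPair.deriv_avg_pd_pd_bound {Θ ζ u : E → ℝ} (hk : IsKernelPair Θ ζ)
    (hu : ContDiff ℝ 2 u) (i j : Fin n) {R M δ : ℝ} (hδ : 0 < δ) (hM : 0 ≤ M)
    (hf : ∀ x y, ‖x‖ ≤ R + 1 → ‖y‖ ≤ R + 1 → ‖x - y‖ ≤ 1 →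
      |elaplacian u x - elaplacian u y| ≤ M * ‖x - y‖ ^ δ) {x : E} (hx : ‖x‖ ≤ R) {s : ℝ}
    (hs : 0 < s) (hs1 : s ≤ 1) :
    |s⁻¹ * avg (pd j (pd i Θ)) (elaplacian u) x s|
      ≤ M * (∫ y, ‖pd j (pd i Θ) y‖) * s ^ (δ - 1) := by
  rw [abs_mul, abs_of_pos (inv_pos.2 hs), rpow_sub_one hs.ne']
  have := abs_avg_pd_pd_le hk.testΘ hu.continuous_elaplacian i j (x := x) (s := s) (M := M * s ^ δ)
    fun z hz => by
      have hsz : ‖s • z‖ ≤ s := by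
        rw [norm_smul, Real.norm_eq_abs, abs_of_pos hs]
        exact mul_le_of_le_one_right hs.le hz
      refine (hf _ _ (norm_add_smul_le hx hs.le hs1 hz) (by linarith)
        (by simpa using hsz.trans hs1)).trans ?_
      gcongr
      simpa using hsz
  calc s⁻¹ * |avg (pd j (pd i Θ)) (elaplacian u) x s|
      ≤ s⁻¹ * (M * s ^ δ * ∫ y, ‖pd j (pd i Θ) y‖) := by gcongr
    _ = _ := by ring

/-- Interior Schauder estimate: uniform Hölder continuity of second derivatives. -/
lemma unifHolder_pd_pd (hn : 0 < n) {u : ι → E → ℝ} (hu : ∀ k, ContDiff ℝ 2 (u k)) {R : ℝ}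
    (i j : Fin n) (h1 : UnifHolder l (fun k => pd j (u k)) (R + 1))
    (h2 : UnifHolder l (fun k => elaplacian (u k)) (R + 1)) :
    UnifHolder l (fun k => pd i (pd j (u k))) R := by
  obtain ⟨Θ, ζ, hk⟩ := exists_isKernelPair hn
  obtain ⟨M₁, γ, hM₁, hγ, hγ1, h1⟩ := h1
  obtain ⟨M₂, δ, hM₂, hδ, hδ1, h2⟩ := h2
  have hI : 0 ≤ ∫ y, ‖pd j (pd i Θ) y‖ := integral_nonneg fun _ => norm_nonneg _
  have hI' : 0 ≤ ∫ y, ‖pd i ζ y‖ := integral_nonneg fun _ => norm_nonneg _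
  have hζ0 := hk.integralζ
  refine ⟨(2 / δ + ∫ y, ‖pd i ζ y‖) / (∫ y, ζ y) * (M₁ + M₂ * ∫ y, ‖pd j (pd i Θ) y‖), δ * γ / 2,
    by positivity, by positivity, by nlinarith, ?_⟩
  filter_upwards [h1, h2] with k hk1 hk2 x y hx hy hxy
  refine holder_of_avg (M := M₁ + M₂ * ∫ y, ‖pd j (pd i Θ) y‖) (β := δ) (γ := γ) hk.testζ
    hk.integralζ ((hu k).pd_one j) i (by positivity) hδ hδ1 hγ (fun x hx => ?_)
    (fun x y hx hy hxy => ?_) hx hy hxy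
  · refine ⟨_, fun s hs hs1 => ⟨hk.hasDerivAt_avg_pd_pd (hu k) i j x hs.ne', ?_⟩⟩
    refine (hk.deriv_avg_pd_pd_bound (hu k) i j hδ hM₂ hk2 hx hs hs1).trans ?_
    gcongr
    linarith
  · refine (hk1 x y hx hy hxy).trans ?_
    gcongr
    linarith [mul_nonneg hM₂ hI]

/-- Interior Schauder estimate: uniform bounds for second derivatives. -/
lemma unifBdd_pd_pd (hn : 0 < n) {u : ι → E → ℝ} (hu : ∀ k, ContDiff ℝ 2 (u k)) {R : ℝ}
    (i j : Fin n) (h1 : UnifBdd l (fun k => pd j (u k)) (R + 1))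
    (h2 : UnifHolder l (fun k => elaplacian (u k)) (R + 1)) :
    UnifBdd l (fun k => pd i (pd j (u k))) R := by
  obtain ⟨Θ, ζ, hk⟩ := exists_isKernelPair hn
  obtain ⟨M₁, h1⟩ := h1
  obtain ⟨M₂, δ, hM₂, hδ, hδ1, h2⟩ := h2
  have hζ0 := hk.integralζ
  refine ⟨(M₁ * (∫ y, ‖pd i ζ y‖) + M₂ * (∫ y, ‖pd j (pd i Θ) y‖) / δ) / ∫ y, ζ y, ?_⟩
  filter_upwards [h1, h2] with k hk1 hk2 x hx
  have k1 := abs_sub_le_of_deriv_rpow hδ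
    (continuous_avg hk.testζ (((hu k).pd_one j).continuous_pd i) x)
    (fun s hs hs1 => ⟨hk.hasDerivAt_avg_pd_pd (hu k) i j x hs.ne',
      hk.deriv_avg_pd_pd_bound (hu k) i j hδ hM₂ hk2 hx hs hs1⟩) one_pos le_rfl
  have k2 := mul_avg_pd hk.testζ ((hu k).pd_one j) i x 1
  have k3 := abs_avg_le (hk.testζ.pd i) (g := pd j (u k)) (x := x) (s := 1) (M := M₁)
    fun z hz => hk1 _ (norm_add_smul_le hx zero_le_one le_rfl hz)
  rw [one_rpow, mul_one, avg_zero] at k1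
  rw [one_mul] at k2
  have e : |pd i (pd j (u k)) x| * ∫ y, ζ y = |(∫ y, ζ y) * pd i (pd j (u k)) x| := by
    rw [abs_mul, abs_of_pos hζ0, mul_comm]
  rw [le_div_iff₀ hζ0, e]
  rw [k2] at k1
  rw [abs_le] at k1 k3 ⊢
  constructor <;> linarith [k1.1, k1.2, k3.1, k3.2]

end Schauder

section Limits

variable {n : ℕ} {ι : Type*} {l : Filter ι}

local notation "E" => EuclideanSpace ℝ (Fin n)

lemma contDiff_add_one_of_pd {F : E → ℝ} {k : ℕ} (hF : Differentiable ℝ F)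
    (hG : ∀ i, ContDiff ℝ k (pd i F)) : ContDiff ℝ (k + 1) F := by
  rw [contDiff_succ_iff_fderiv]
  refine ⟨hF, fun h => absurd h (by simp), ?_⟩
  have : fderiv ℝ F = fun x => ∑ i, pd i F x • (EuclideanSpace.proj i : E →L[ℝ] ℝ) := by
    ext x y
    rw [fderiv_apply_eq_sum]
    simp [mul_comm]
  rw [this]
  exact ContDiff.sum fun i _ => (hG i).smul contDiff_const

lemma UnifHolder.abs_sub_le_of_tendsto [l.NeBot] {g : ι → E → ℝ} {G : E → ℝ} {R : ℝ}
    (h : UnifHolder l g R) (hG : ∀ x, Tendsto (fun k => g k x) l (𝓝 (G x))) :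
    ∃ M δ : ℝ, 0 < δ ∧ ∀ x y, ‖x‖ ≤ R → ‖y‖ ≤ R → ‖x - y‖ ≤ 1 → |G x - G y| ≤ M * ‖x - y‖ ^ δ := by
  obtain ⟨M, δ, -, hδ, -, hM⟩ := h
  exact ⟨M, δ, hδ, fun x y hx hy hxy => le_of_tendsto ((hG x).sub (hG y)).abs
    (hM.mono fun k hk => hk x y hx hy hxy)⟩

lemma tendsto_mul_norm_sub_rpow (x : E) (M : ℝ) {δ : ℝ} (hδ : 0 < δ) :
    Tendsto (fun y => M * ‖y - x‖ ^ δ) (𝓝 x) (𝓝 0) := by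
  have : Continuous fun y : E => M * ‖y - x‖ ^ δ :=
    continuous_const.mul ((by fun_prop : Continuous fun y : E => ‖y - x‖).rpow_const
      fun _ => Or.inr hδ.le)
  simpa [zero_rpow hδ.ne'] using this.tendsto x

lemma eventually_norm_sub_le_one (x : E) : ∀ᶠ y in 𝓝 x, ‖y - x‖ ≤ 1 := by
  filter_upwards [Metric.closedBall_mem_nhds x one_pos] with y hy
  simpa [dist_eq_norm] using hy

lemma norm_le_add_one {x y : E} (h : ‖y - x‖ ≤ 1) : ‖y‖ ≤ ‖x‖ + 1 := by
  have := norm_add_le x (y - x)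
  rw [add_sub_cancel] at this
  linarith

lemma continuous_of_unifHolder [l.NeBot] {g : ι → E → ℝ} {G : E → ℝ}
    (h : ∀ R, UnifHolder l g R) (hG : ∀ x, Tendsto (fun k => g k x) l (𝓝 (G x))) :
    Continuous G := by
  rw [continuous_iff_continuousAt]
  intro x
  obtain ⟨M, δ, hδ, hM⟩ := (h (‖x‖ + 1)).abs_sub_le_of_tendsto hG
  rw [ContinuousAt, tendsto_iff_dist_tendsto_zero]
  refine squeeze_zero' (Eventually.of_forall fun _ => dist_nonneg) ?_
    (tendsto_mul_norm_sub_rpow x M hδ)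
  filter_upwards [eventually_norm_sub_le_one x] with y hy
  exact hM y x (norm_le_add_one hy) (by linarith) hy

lemma hasFDerivAt_of_unifHolder [l.NeBot] {F : ι → E → ℝ} {F₀ : E → ℝ} {G : Fin n → E → ℝ}
    (hF : ∀ k, Differentiable ℝ (F k)) (hlim : ∀ x, Tendsto (fun k => F k x) l (𝓝 (F₀ x)))
    (hG : ∀ i x, Tendsto (fun k => pd i (F k) x) l (𝓝 (G i x)))
    (hH : ∀ i R, UnifHolder l (fun k => pd i (F k)) R) (x : E) :
    HasFDerivAt F₀ (∑ i, G i x • (EuclideanSpace.proj i : E →L[ℝ] ℝ)) x := by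
  choose M δ hM hδ hδ1 hev using fun i => hH i (‖x‖ + 1)
  have hb (y : E) (hy : ‖y - x‖ ≤ 1) :
      |F₀ y - F₀ x - ∑ i, (y i - x i) * G i x| ≤ (∑ i, M i * ‖y - x‖ ^ δ i) * ‖y - x‖ := by
    refine le_of_tendsto (((hlim y).sub (hlim x)).sub
      (tendsto_finsetSum _ fun i _ => (hG i x).const_mul (y i - x i))).abs ?_
    filter_upwards [eventually_all.2 hev] with k hk
    have hseg (z : E) (hz : z ∈ segment ℝ x y) : ‖z - x‖ ≤ ‖y - x‖ := by
      obtain ⟨t, ⟨ht0, ht1⟩, rfl⟩ := (segment_eq_image' ℝ x y) ▸ hz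
      simp only [add_sub_cancel_left, norm_smul, Real.norm_eq_abs, abs_of_nonneg ht0]
      exact mul_le_of_le_one_left (norm_nonneg _) ht1
    have := (convex_segment (𝕜 := ℝ) x y).norm_image_sub_le_of_norm_fderiv_le' (𝕜 := ℝ) (f := F k)
      (φ := fderiv ℝ (F k) x) (C := ∑ i, M i * ‖y - x‖ ^ δ i) (fun z _ => hF k z)
      (fun z hz => ?_) (left_mem_segment ℝ x y) (right_mem_segment ℝ x y)
    · rw [fderiv_apply_eq_sum] at this
      exact this
    · refine (norm_clm_le _).trans (Finset.sum_le_sum fun i _ => ?_)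
      have h1 := hseg z hz
      have h2 := hk i z x (norm_le_add_one (h1.trans hy)) (by linarith) (h1.trans hy)
      refine h2.trans ?_
      have := hM i
      have := (hδ i).le
      gcongr
  rw [hasFDerivAt_iff_isLittleO, Asymptotics.isLittleO_iff]
  intro ε hε
  have ht : Tendsto (fun y => ∑ i, M i * ‖y - x‖ ^ δ i) (𝓝 x) (𝓝 0) := by
    simpa using tendsto_finsetSum Finset.univ fun i _ => tendsto_mul_norm_sub_rpow x (M i) (hδ i)
  filter_upwards [eventually_norm_sub_le_one x, ht.eventually_le_const hε] with y hy hyε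
  have e : (∑ i, G i x • (EuclideanSpace.proj i : E →L[ℝ] ℝ)) (y - x)
      = ∑ i, (y i - x i) * G i x := by simp [mul_comm]
  rw [e]
  exact (hb y hy).trans (by gcongr)

/-- Limits of families with uniformly Hölder gradients are continuously differentiable. -/
lemma contDiff_one_of_unifHolder [l.NeBot] {F : ι → E → ℝ} {F₀ : E → ℝ} {G : Fin n → E → ℝ}
    (hF : ∀ k, Differentiable ℝ (F k)) (hlim : ∀ x, Tendsto (fun k => F k x) l (𝓝 (F₀ x)))
    (hG : ∀ i x, Tendsto (fun k => pd i (F k) x) l (𝓝 (G i x)))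
    (hH : ∀ i R, UnifHolder l (fun k => pd i (F k)) R) :
    ContDiff ℝ 1 F₀ ∧ ∀ i, pd i F₀ = G i := by
  have hd := hasFDerivAt_of_unifHolder hF hlim hG hH
  have hp (i : Fin n) : pd i F₀ = G i := by
    ext x
    rw [pd, (hd x).fderiv]
    simp
  refine ⟨?_, hp⟩
  have := contDiff_add_one_of_pd (k := 0) (fun x => (hd x).differentiableAt) fun i => by
    rw [hp]
    exact_mod_cast contDiff_zero.2 (continuous_of_unifHolder (hH i) (hG i))
  simpa using this

lemma exists_tendsto_of_abs_le (𝒰 : Ultrafilter ι) {a : ι → ℝ} {M : ℝ} (h : ∀ᶠ k in 𝒰, |a k| ≤ M) :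
    ∃ L, Tendsto a 𝒰 (𝓝 L) := by
  have h1 : ↑(𝒰.map a) ≤ 𝓟 (Icc (-M) M) := by
    rw [le_principal_iff]
    exact h.mono fun k hk => abs_le.1 hk
  obtain ⟨L, -, hL⟩ := isCompact_Icc.ultrafilter_le_nhds _ h1
  exact ⟨L, hL⟩

lemma abs_rpow_sub_rpow_le {r a b : ℝ} (hr : 0 ≤ r) (hr1 : r ≤ 1) (ha : 0 ≤ a) (hb : 0 ≤ b) :
    |a ^ r - b ^ r| ≤ |a - b| ^ r := by
  wlog hab : b ≤ a generalizing a b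
  · rw [abs_sub_comm, abs_sub_comm a]
    exact this hb ha (le_of_not_ge hab)
  rw [abs_of_nonneg (sub_nonneg.2 (rpow_le_rpow hb hab hr)), abs_of_nonneg (sub_nonneg.2 hab)]
  have := Real.rpow_add_le_add_rpow (sub_nonneg.2 hab) hb hr hr1
  rw [sub_add_cancel] at this
  linarith

lemma exists_lipschitz_rpow {a b r : ℝ} (h : 0 < a ∨ 1 ≤ r) :
    ∃ L, 0 ≤ L ∧ ∀ s ∈ Icc a b, ∀ t ∈ Icc a b, |s ^ r - t ^ r| ≤ L * |s - t| ^ (1 : ℝ) := by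
  have hne (s : ℝ) (hs : s ∈ Icc a b) : s ≠ 0 ∨ 1 ≤ r := h.imp (fun h => (h.trans_le hs.1).ne') id
  have hc : ContinuousOn (fun s : ℝ => r * s ^ (r - 1)) (Icc a b) :=
    continuousOn_const.mul (continuousOn_id.rpow_const fun s hs =>
      (hne s hs).imp id fun h => by linarith)
  obtain ⟨L, hL⟩ := isCompact_Icc.exists_bound_of_continuousOn hc
  refine ⟨max L 0, le_max_right _ _, fun s hs t ht => ?_⟩
  rw [rpow_one]
  exact (convex_Icc a b).norm_image_sub_le_of_norm_hasDerivWithin_le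
    (fun x hx => (Real.hasDerivAt_rpow_const (hne x hx)).hasDerivWithinAt)
    (fun x hx => (hL x hx).trans (le_max_left _ _)) ht hs

lemma exists_holder_rpow {r : ℝ} (hr : 0 ≤ r) (B : ℝ) :
    ∃ L β : ℝ, 0 ≤ L ∧ 0 < β ∧ β ≤ 1 ∧
      ∀ s ∈ Icc 0 B, ∀ t ∈ Icc 0 B, |s ^ r - t ^ r| ≤ L * |s - t| ^ β := by
  rcases hr.eq_or_lt with rfl | hr0
  · exact ⟨0, 1, le_rfl, one_pos, le_rfl, fun s _ t _ => by simp⟩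
  rcases le_total r 1 with h | h
  · exact ⟨1, r, zero_le_one, hr0, h, fun s hs t ht => by
      simpa using abs_rpow_sub_rpow_le hr h hs.1 ht.1⟩
  · obtain ⟨L, hL, hL'⟩ := exists_lipschitz_rpow (a := 0) (b := B) (Or.inr h)
    exact ⟨L, 1, hL, one_pos, le_rfl, hL'⟩

lemma UnifHolder.comp {g : ι → E → ℝ} {R : ℝ} (hg : UnifHolder l g R) {φ : ℝ → ℝ} {S : Set ℝ}
    {L β : ℝ} (hL : 0 ≤ L) (hβ : 0 < β) (hβ1 : β ≤ 1)
    (hφ : ∀ s ∈ S, ∀ t ∈ S, |φ s - φ t| ≤ L * |s - t| ^ β)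
    (hS : ∀ᶠ k in l, ∀ x, ‖x‖ ≤ R → g k x ∈ S) : UnifHolder l (fun k x => φ (g k x)) R := by
  obtain ⟨M, δ, hM, hδ, hδ1, hev⟩ := hg
  refine ⟨L * M ^ β, δ * β, by positivity, by positivity, by nlinarith, ?_⟩
  filter_upwards [hev, hS] with k hk hkS x y hx hy hxy
  refine (hφ _ (hkS x hx) _ (hkS y hy)).trans ?_
  rw [rpow_mul (norm_nonneg _), mul_assoc, ← mul_rpow hM (by positivity)]
  gcongr
  exact hk x y hx hy hxy

lemma UnifHolder.const (a : ι → ℝ) (R : ℝ) : UnifHolder l (fun k (_ : E) => a k) R :=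
  ⟨0, 1, le_rfl, one_pos, le_rfl, Eventually.of_forall fun k x y _ _ _ => by simp⟩

lemma UnifHolder.add {g h : ι → E → ℝ} {R : ℝ} (hg : UnifHolder l g R) (hh : UnifHolder l h R) :
    UnifHolder l (fun k x => g k x + h k x) R := by
  obtain ⟨M, δ, hM, hδ, hδ1, hev⟩ := hg
  obtain ⟨M', δ', hM', hδ', hδ1', hev'⟩ := hh
  refine ⟨M + M', min δ δ', by positivity, by positivity, (min_le_left _ _).trans hδ1, ?_⟩
  filter_upwards [hev, hev'] with k hk hk' x y hx hy hxy
  rcases (norm_nonneg (x - y)).eq_or_lt with h0 | h0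
  · simp [sub_eq_zero.1 (norm_eq_zero.1 h0.symm)]
    positivity
  have h1 := hk x y hx hy hxy
  have h2 := hk' x y hx hy hxy
  have e1 := rpow_le_rpow_of_exponent_ge h0 hxy (min_le_left δ δ')
  have e2 := rpow_le_rpow_of_exponent_ge h0 hxy (min_le_right δ δ')
  rw [add_sub_add_comm, add_mul]
  exact (abs_add_le _ _).trans (add_le_add (h1.trans (by gcongr)) (h2.trans (by gcongr)))

lemma UnifHolder.sum {κ : Type*} {g : κ → ι → E → ℝ} {R : ℝ} (hg : ∀ i, UnifHolder l (g i) R)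
    (s : Finset κ) : UnifHolder l (fun k x => ∑ i ∈ s, g i k x) R := by
  classical
  induction s using Finset.induction_on with
  | empty => simpa using UnifHolder.const (l := l) (n := n) (fun _ => 0) R
  | insert i s hi ih => simpa [Finset.sum_insert hi] using (hg i).add ih

lemma UnifHolder.const_mul {a : ι → ℝ} {A : ℝ} (ha : ∀ᶠ k in l, |a k| ≤ A) {h : ι → E → ℝ} {R : ℝ}
    (hh : UnifHolder l h R) : UnifHolder l (fun k x => a k * h k x) R := by
  obtain ⟨M, δ, hM, hδ, hδ1, hev⟩ := hh
  refine ⟨|A| * M, δ, by positivity, hδ, hδ1, ?_⟩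
  filter_upwards [ha, hev] with k hk hk' x y hx hy hxy
  rw [← mul_sub, abs_mul, mul_assoc]
  exact mul_le_mul (hk.trans (le_abs_self A)) (hk' x y hx hy hxy) (abs_nonneg _) (abs_nonneg _)

lemma UnifHolder.mul {g h : ι → E → ℝ} {R : ℝ} (hg : UnifHolder l g R) (hh : UnifHolder l h R)
    (bg : UnifBdd l g R) (bh : UnifBdd l h R) : UnifHolder l (fun k x => g k x * h k x) R := by
  obtain ⟨M, δ, hM, hδ, hδ1, hev⟩ := hg
  obtain ⟨M', δ', hM', hδ', hδ1', hev'⟩ := hh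
  obtain ⟨B, hB, hbg⟩ := bg.exists_nonneg
  obtain ⟨B', hB', hbh⟩ := bh.exists_nonneg
  refine ⟨B * M' + B' * M, min δ δ', by positivity, by positivity,
    (min_le_left _ _).trans hδ1, ?_⟩
  filter_upwards [hev, hev', hbg, hbh] with k hk hk' hkg hkh x y hx hy hxy
  rcases (norm_nonneg (x - y)).eq_or_lt with h0 | h0
  · simp [sub_eq_zero.1 (norm_eq_zero.1 h0.symm)]
    positivity
  have h1 := hk x y hx hy hxy
  have h2 := hk' x y hx hy hxy
  have e1 := rpow_le_rpow_of_exponent_ge h0 hxy (min_le_left δ δ')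
  have e2 := rpow_le_rpow_of_exponent_ge h0 hxy (min_le_right δ δ')
  have hs : g k x * h k x - g k y * h k y = g k x * (h k x - h k y) + h k y * (g k x - g k y) := by
    ring
  rw [hs, add_mul]
  refine (abs_add_le _ _).trans ?_
  rw [abs_mul, abs_mul, mul_assoc, mul_assoc]
  refine add_le_add (mul_le_mul (hkg x hx) (h2.trans (by gcongr)) (abs_nonneg _) hB)
    (mul_le_mul (hkh y hy) (h1.trans (by gcongr)) (abs_nonneg _) hB')

end Limits

section Compactness

variable {n : ℕ} {ι : Type*} {l : Filter ι}

local notation "E" => EuclideanSpace ℝ (Fin n)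

/-- Positive entire classical solutions of `Δu + c |∇u|^q u^p = 0`. -/
structure IsSol (c p q : ℝ) (u : E → ℝ) : Prop where
  contDiff : ContDiff ℝ 2 u
  pos : ∀ x, 0 < u x
  eq : ∀ x, elaplacian u x = -(c * (gradSq u x ^ (q / 2) * u x ^ p))

lemma pd_log {u : E → ℝ} {x : E} (hu : DifferentiableAt ℝ u x) (hpos : 0 < u x) (i : Fin n) :
    pd i (fun y => log (u y)) x = (u x)⁻¹ * pd i u x :=
  pd_comp i (Real.hasDerivAt_log hpos.ne') hu

lemma gradSq_log {u : E → ℝ} {x : E} (hu : DifferentiableAt ℝ u x) (hpos : 0 < u x) :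
    gradSq (fun y => log (u y)) x = gradSq u x / u x ^ 2 := by
  simp only [gradSq, pd_log hu hpos, Finset.sum_div]
  exact Finset.sum_congr rfl fun i _ => by field_simp

namespace IsSol

variable {c p q : ℝ} {u : EuclideanSpace ℝ (Fin n) → ℝ}

lemma contDiff_log (h : IsSol c p q u) : ContDiff ℝ 2 fun y => log (u y) :=
  h.contDiff.log fun x => (h.pos x).ne'

lemma differentiable (h : IsSol c p q u) : Differentiable ℝ u := h.contDiff.differentiable (by simp)

lemma gradSq_log (h : IsSol c p q u) (x : E) :
    gradSq (fun y => log (u y)) x = gradSq u x / u x ^ 2 :=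
  _root_.gradSq_log (h.differentiable x) (h.pos x)

lemma gradSq_eq (h : IsSol c p q u) (x : E) :
    gradSq u x = gradSq (fun y => log (u y)) x * u x ^ 2 := by
  have := (h.pos x).ne'
  rw [h.gradSq_log]
  field_simp

lemma source_eq (h : IsSol c p q u) (x : E) :
    gradSq (fun y => log (u y)) x ^ (q / 2) * exp ((p + q - 1) * log (u x))
      = gradSq u x ^ (q / 2) * u x ^ (p - 1) := by
  have hx := h.pos x
  rw [h.gradSq_eq, mul_rpow (gradSq_nonneg _ _) (by positivity), ← rpow_natCast (u x) 2,
    ← rpow_mul hx.le, mul_assoc, ← rpow_add hx, mul_comm (p + q - 1), ← rpow_def_of_pos hx]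
  congr 2
  push_cast
  ring

lemma elaplacian_log (h : IsSol c p q u) (x : E) :
    elaplacian (fun y => log (u y)) x = -gradSq (fun y => log (u y)) x
      - c * (gradSq (fun y => log (u y)) x ^ (q / 2) * exp ((p + q - 1) * log (u x))) := by
  have hx := h.pos x
  have h1 (i : Fin n) : pd i (fun y => log (u y)) = fun y => (u y)⁻¹ * pd i u y :=
    funext fun y => pd_log (h.differentiable y) (h.pos y) i
  have h2 (i : Fin n) : pd i (pd i (fun y => log (u y))) x
      = (u x)⁻¹ * pd i (pd i u) x - pd i u x ^ 2 / u x ^ 2 := by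
    rw [h1, pd_mul i ((h.differentiable x).fun_inv hx.ne')
      ((h.contDiff.pd_one i).differentiable (by simp) x),
      pd_comp i (ρ := fun t => t⁻¹) (hasDerivAt_inv hx.ne') (h.differentiable x)]
    field_simp
    ring
  rw [h.source_eq, h.gradSq_log, elaplacian_eq]
  simp only [h2, Finset.sum_sub_distrib, ← Finset.mul_sum, ← Finset.sum_div]
  rw [← elaplacian_eq, h.eq, rpow_sub_one hx.ne', ← gradSq]
  field_simp
  ring

end IsSol

lemma unifHolder_of_fderiv {u : ι → E → ℝ} (hu : ∀ k, Differentiable ℝ (u k)) {R : ℝ}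
    (h : UnifBdd l (fun k x => ‖fderiv ℝ (u k) x‖) R) : UnifHolder l u R := by
  obtain ⟨M, hM, h⟩ := h.exists_nonneg
  refine ⟨M, 1, hM, one_pos, le_rfl, ?_⟩
  filter_upwards [h] with k hk x y hx hy _
  rw [rpow_one]
  exact (convex_closedBall (0 : E) R).norm_image_sub_le_of_norm_fderiv_le (𝕜 := ℝ)
    (fun z _ => hu k z) (fun z hz => by simpa using hk z (by simpa using hz))
    (by simpa using hy) (by simpa using hx)

/-- Compactness of normalised solutions with locally bounded logarithmic gradient. -/
lemma exists_limit_isSol (hn : 0 < n) {p q A : ℝ} (hq : 0 ≤ q) {v : ℕ → E → ℝ} {c : ℕ → ℝ}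
    (hc : ∀ k, 0 ≤ c k) (hcA : ∀ k, c k ≤ A) (hv : ∀ k, IsSol (c k) p q (v k))
    (hv0 : ∀ k, v k 0 = 1) (hg0 : ∀ k, gradSq (fun y => log (v k y)) 0 = 1)
    (hg : ∀ k : ℕ, ∀ x, ‖x‖ ≤ k → gradSq (fun y => log (v k y)) x ≤ 4) :
    ∃ v₀ : E → ℝ, ∃ c₀, 0 ≤ c₀ ∧ IsSol c₀ p q v₀ ∧ gradSq (fun y => log (v₀ y)) 0 = 1 ∧
      ∀ x, gradSq (fun y => log (v₀ y)) x ≤ 4 := by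
  set 𝒰 : Ultrafilter ℕ := hyperfilter ℕ
  have hev (R : ℝ) : ∀ᶠ k : ℕ in 𝒰, R ≤ k :=
    Nat.hyperfilter_le_atTop (tendsto_natCast_atTop_atTop.eventually_ge_atTop R)
  have hlog {k : ℕ} {R : ℝ} (hk : R ≤ k) {x : E} (hx : ‖x‖ ≤ R) : |log (v k x)| ≤ 2 * R := by
    have := abs_sub_le_of_gradSq_le (y₀ := 0) (x := x) (r := k) (hv k).contDiff_log
      (fun y hy => hg k y (by simpa using hy)) (by simpa using hx.trans hk)
    simp only [hv0, log_one, sub_zero] at this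
    linarith
  have hIcc {k : ℕ} {R : ℝ} (hk : R ≤ k) {x : E} (hx : ‖x‖ ≤ R) :
      v k x ∈ Icc (exp (-(2 * R))) (exp (2 * R)) := by
    have := abs_le.1 (hlog hk hx)
    rw [← exp_log ((hv k).pos x)]
    exact ⟨exp_le_exp.2 this.1, exp_le_exp.2 this.2⟩
  have hz {k : ℕ} {R : ℝ} (hk : R ≤ k) {x : E} (hx : ‖x‖ ≤ R) :
      gradSq (v k) x ≤ 4 * exp (2 * R) ^ 2 := by
    have h0 := (hv k).pos x
    rw [(hv k).gradSq_eq]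
    have := hg k x (hx.trans hk)
    have := (hIcc hk hx).2
    gcongr
  have bv (R : ℝ) : UnifBdd 𝒰 v R := ⟨exp (2 * R), (hev R).mono fun k hk x hx => by
    rw [abs_of_pos ((hv k).pos x)]
    exact (hIcc hk hx).2⟩
  have bf (R : ℝ) : UnifBdd 𝒰 (fun k x => ‖fderiv ℝ (v k) x‖) R :=
    ⟨2 * exp (2 * R), (hev R).mono fun k hk x hx => by
      have := hz hk hx
      rw [gradSq_eq] at this
      rw [abs_norm]
      nlinarith [norm_nonneg (fderiv ℝ (v k) x), exp_pos (2 * R)]⟩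
  have bp (R : ℝ) (i : Fin n) : UnifBdd 𝒰 (fun k => pd i (v k)) R := by
    obtain ⟨M, hM⟩ := bf R
    exact ⟨M, hM.mono fun k hk x hx => (abs_pd_le _ _ _).trans ((le_abs_self _).trans (hk x hx))⟩
  have hel (k : ℕ) : elaplacian (v k) = fun x => -c k * (gradSq (v k) x ^ (q / 2) * v k x ^ p) :=
    funext fun x => by rw [(hv k).eq]; ring
  have hcb : ∀ᶠ k in (𝒰 : Filter ℕ), |-c k| ≤ A :=
    Eventually.of_forall fun k => by rw [abs_neg, abs_of_nonneg (hc k)]; exact hcA k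
  have bz (R : ℝ) : UnifBdd 𝒰 (fun k x => gradSq (v k) x ^ (q / 2)) R :=
    ⟨(4 * exp (2 * R) ^ 2) ^ (q / 2), (hev R).mono fun k hk x hx => by
      have := gradSq_nonneg (v k) x
      rw [abs_of_nonneg (by positivity)]
      exact rpow_le_rpow this (hz hk hx) (by positivity)⟩
  have bvp (R : ℝ) : UnifBdd 𝒰 (fun k x => v k x ^ p) R :=
    ⟨exp (2 * R * |p|), (hev R).mono fun k hk x hx => by
      have h0 := (hv k).pos x
      change |v k x ^ p| ≤ _
      rw [abs_of_pos (by positivity), rpow_def_of_pos h0, exp_le_exp]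
      refine (le_abs_self _).trans ?_
      rw [abs_mul]
      gcongr
      exact hlog hk hx⟩
  have bΔ (R : ℝ) : UnifBdd 𝒰 (fun k => elaplacian (v k)) R := by
    obtain ⟨M, hM, h1⟩ := (bz R).exists_nonneg
    obtain ⟨M', hM', h2⟩ := (bvp R).exists_nonneg
    refine ⟨A * (M * M'), ?_⟩
    filter_upwards [h1, h2, hcb] with k hk1 hk2 hk3 x hx
    rw [hel, abs_mul, abs_mul]
    exact mul_le_mul hk3 (mul_le_mul (hk1 x hx) (hk2 x hx) (abs_nonneg _) hM) (by positivity)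
      ((abs_nonneg _).trans hk3)
  have Hp (R : ℝ) (i : Fin n) : UnifHolder 𝒰 (fun k => pd i (v k)) R :=
    unifHolder_pd hn (fun k => (hv k).contDiff) (bf _) (bΔ _) i
  have HΔ (R : ℝ) : UnifHolder 𝒰 (fun k => elaplacian (v k)) R := by
    rw [funext hel]
    refine UnifHolder.const_mul hcb (UnifHolder.mul ?_ ?_ (bz R) (bvp R))
    · obtain ⟨L, β, hL, hβ, hβ1, hφ⟩ := exists_holder_rpow (r := q / 2) (by positivity)
        (4 * exp (2 * R) ^ 2)
      refine UnifHolder.comp (g := fun k => gradSq (v k)) ?_ hL hβ hβ1 hφ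
        ((hev R).mono fun k hk x hx => ⟨gradSq_nonneg _ _, hz hk hx⟩)
      unfold gradSq
      simp only [sq]
      exact UnifHolder.sum (fun i => (Hp R i).mul (Hp R i) (bp R i) (bp R i)) Finset.univ
    · obtain ⟨L, hL, hφ⟩ := exists_lipschitz_rpow (a := exp (-(2 * R))) (b := exp (2 * R)) (r := p)
        (Or.inl (exp_pos _))
      exact UnifHolder.comp (unifHolder_of_fderiv (fun k => (hv k).differentiable) (bf R)) hL
        one_pos le_rfl hφ ((hev R).mono fun k hk x hx => hIcc hk hx)
  have Hpp (R : ℝ) (i j : Fin n) : UnifHolder 𝒰 (fun k => pd i (pd j (v k))) R :=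
    unifHolder_pd_pd hn (fun k => (hv k).contDiff) i j (Hp _ j) (HΔ _)
  have bpp (R : ℝ) (i j : Fin n) : UnifBdd 𝒰 (fun k => pd i (pd j (v k))) R :=
    unifBdd_pd_pd hn (fun k => (hv k).contDiff) i j (bp _ j) (HΔ _)
  have hlim {g : ℕ → E → ℝ} (hb : ∀ R, UnifBdd 𝒰 g R) (x : E) :
      ∃ L, Tendsto (fun k => g k x) 𝒰 (𝓝 L) := by
    obtain ⟨M, hM⟩ := hb ‖x‖
    exact exists_tendsto_of_abs_le 𝒰 (hM.mono fun k hk => hk x le_rfl)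
  choose v₀ hv₀ using hlim bv
  choose g hgl using fun i => hlim fun R => bp R i
  choose h hhl using fun i j => hlim fun R => bpp R i j
  obtain ⟨c₀, hc₀⟩ := exists_tendsto_of_abs_le 𝒰 (a := c) (M := A)
    (Eventually.of_forall fun k => by rw [abs_of_nonneg (hc k)]; exact hcA k)
  obtain ⟨hC1, hpd⟩ := contDiff_one_of_unifHolder (fun k => (hv k).differentiable) hv₀ hgl
    fun i R => Hp R i
  have hC2 (j : Fin n) := contDiff_one_of_unifHolder
    (fun k => ((hv k).contDiff.pd_one j).differentiable (by simp)) (hgl j) (fun i => hhl i j)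
    fun i R => Hpp R i j
  have hC : ContDiff ℝ 2 v₀ := by
    have := contDiff_add_one_of_pd (k := 1) (hC1.differentiable (by simp)) fun i => by
      rw [hpd]
      exact_mod_cast (hC2 i).1
    simpa [one_add_one_eq_two] using this
  have hpos (x : E) : 0 < v₀ x :=
    lt_of_lt_of_le (exp_pos (-(2 * ‖x‖))) (ge_of_tendsto (hv₀ x)
      ((hev ‖x‖).mono fun k hk => (hIcc hk le_rfl).1))
  have hgs (x : E) : Tendsto (fun k => gradSq (v k) x) 𝒰 (𝓝 (gradSq v₀ x)) := by
    simp only [gradSq, hpd]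
    exact tendsto_finsetSum _ fun i _ => (hgl i x).pow 2
  have hglog (x : E) : Tendsto (fun k => gradSq (fun y => log (v k y)) x) 𝒰
      (𝓝 (gradSq (fun y => log (v₀ y)) x)) := by
    rw [gradSq_log (hC.differentiable (by simp) x) (hpos x)]
    simp only [fun k => (hv k).gradSq_log x]
    exact (hgs x).div ((hv₀ x).pow 2) (pow_ne_zero 2 (hpos x).ne')
  refine ⟨v₀, c₀, ge_of_tendsto hc₀ (Eventually.of_forall hc), ⟨hC, hpos, fun x => ?_⟩, ?_,
    fun x => ?_⟩
  · have h1 : Tendsto (fun k => elaplacian (v k) x) 𝒰 (𝓝 (elaplacian v₀ x)) := by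
      simp only [elaplacian_eq, hpd, (hC2 _).2]
      exact tendsto_finsetSum _ fun i _ => hhl i i x
    refine tendsto_nhds_unique h1 ?_
    simp only [fun k => (hv k).eq x]
    exact (hc₀.mul (((hgs x).rpow_const (Or.inr (by positivity))).mul
      ((hv₀ x).rpow_const (Or.inl (hpos x).ne')))).neg
  · refine tendsto_nhds_unique (hglog 0) ?_
    simp only [hg0]
    exact tendsto_const_nhds
  · exact le_of_tendsto (hglog x) ((hev ‖x‖).mono fun k hk => hg k x hk)

end Compactness

section Liouville

variable {n : ℕ}

local notation "E" => EuclideanSpace ℝ (Fin n)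

lemma pd_affine {u : E → ℝ} (hu : Differentiable ℝ u) (a s : ℝ) (x₀ y : E) (i : Fin n) :
    pd i (fun y => a * u (x₀ + s • y)) y = a * s * pd i u (x₀ + s • y) := by
  have h1 : HasFDerivAt (fun y : E => x₀ + s • y) (s • ContinuousLinearMap.id ℝ E) y :=
    ((hasFDerivAt_id y).const_smul s).const_add x₀
  have h2 := ((hu (x₀ + s • y)).hasFDerivAt.comp y h1).const_mul a
  change fderiv ℝ (fun y => a * (u ∘ fun y => x₀ + s • y) y) y _ = _
  rw [h2.fderiv]
  simp [pd, mul_assoc]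

lemma gradSq_affine {u : E → ℝ} (hu : Differentiable ℝ u) (a s : ℝ) (x₀ y : E) :
    gradSq (fun y => a * u (x₀ + s • y)) y = (a * s) ^ 2 * gradSq u (x₀ + s • y) := by
  simp only [gradSq, pd_affine hu, Finset.mul_sum, mul_pow]

lemma gradSq_gradient_rpow (u : E → ℝ) (x : E) (q : ℝ) :
    ‖gradient u x‖ ^ q = gradSq u x ^ (q / 2) := by
  rw [norm_gradient, gradSq_eq, ← rpow_natCast, ← rpow_mul (norm_nonneg _)]
  congr 1
  push_cast
  ring

lemma isSol_one_iff {p q : ℝ} {u : E → ℝ} : IsSol 1 p q u ↔ ContDiff ℝ 2 u ∧ (∀ x, 0 < u x) ∧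
    ∀ x, elaplacian u x + ‖gradient u x‖ ^ q * u x ^ p = 0 := by
  simp only [gradSq_gradient_rpow, add_eq_zero_iff_eq_neg]
  exact ⟨fun h => ⟨h.contDiff, h.pos, by simpa using h.eq⟩,
    fun h => ⟨h.1, h.2.1, by simpa using h.2.2⟩⟩

namespace IsSol

variable {c p q : ℝ} {u : EuclideanSpace ℝ (Fin n) → ℝ}

lemma affine (h : IsSol c p q u) {a s : ℝ} (ha : 0 < a) (hs : 0 < s) (x₀ : E) :
    IsSol (c * s ^ (2 - q) * a ^ (1 - p - q)) p q fun y => a * u (x₀ + s • y) where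
  contDiff := contDiff_const.mul (h.contDiff.comp (by fun_prop))
  pos y := mul_pos ha (h.pos _)
  eq y := by
    have h1 (i : Fin n) : pd i (fun y => a * u (x₀ + s • y))
        = fun y => a * s * pd i u (x₀ + s • y) :=
      funext fun y => pd_affine h.differentiable a s x₀ y i
    have h2 : elaplacian (fun y => a * u (x₀ + s • y)) y
        = a * s ^ 2 * elaplacian u (x₀ + s • y) := by
      simp only [elaplacian_eq, h1, Finset.mul_sum,
        fun i => pd_affine ((h.contDiff.pd_one i).differentiable (by simp)) (a * s) s x₀ y i]
      exact Finset.sum_congr rfl fun i _ => by ring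
    have h3 : ((a * s) ^ 2) ^ (q / 2) = a ^ q * s ^ q := by
      rw [← mul_rpow ha.le hs.le, ← rpow_natCast, ← rpow_mul (by positivity)]
      congr 1
      push_cast
      ring
    have h4 : s ^ (2 - q) * s ^ q = s ^ 2 := by
      rw [← rpow_add hs, ← rpow_natCast]
      congr 1
      push_cast
      ring
    have h5 : a ^ (1 - p - q) * a ^ q * a ^ p = a := by
      rw [← rpow_add ha, ← rpow_add ha]
      ring_nf
      exact rpow_one a
    rw [h2, h.eq, gradSq_affine h.differentiable, mul_rpow (by positivity) (gradSq_nonneg _ _), h3,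
      mul_rpow ha.le (h.pos _).le]
    calc _ = -((s ^ 2 * a) * (c * (gradSq u (x₀ + s • y) ^ (q / 2) * u (x₀ + s • y) ^ p))) := by
          ring
      _ = -((s ^ (2 - q) * s ^ q * (a ^ (1 - p - q) * a ^ q * a ^ p)) *
          (c * (gradSq u (x₀ + s • y) ^ (q / 2) * u (x₀ + s • y) ^ p))) := by rw [h4, h5]
      _ = _ := by ring

lemma gradSq_log_affine (h : IsSol c p q u) {a : ℝ} (ha : 0 < a) (s : ℝ) (x₀ y : E) :
    gradSq (fun y => log (a * u (x₀ + s • y))) y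
      = s ^ 2 * gradSq (fun y => log (u y)) (x₀ + s • y) := by
  have hpos := h.pos (x₀ + s • y)
  rw [_root_.gradSq_log (u := fun y => a * u (x₀ + s • y)) (x := y) ?_ (by positivity),
    gradSq_affine h.differentiable, h.gradSq_log]
  · field_simp
  · exact ((h.differentiable _).comp y (by fun_prop)).const_mul a

lemma eq_of_gradSq_log_eq_zero (h : IsSol c p q u)
    (h0 : ∀ x, gradSq (fun y => log (u y)) x = 0) (x y : E) : u x = u y := by
  have h1 : log (u x) = log (u y) :=
    is_const_of_fderiv_eq_zero (𝕜 := ℝ) (h.contDiff_log.differentiable (by simp)) (fun z => by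
      have := h0 z
      rw [_root_.gradSq_eq] at this
      simpa using this) x y
  exact log_injOn_pos (h.pos x) (h.pos y) h1

end IsSol

/-- The doubling property of positive values of continuous functions. -/
lemma exists_doubling {X : Type*} [NormedAddCommGroup X] [ProperSpace X] {N : X → ℝ}
    (hN : Continuous N) {x₀ : X} (hx₀ : 0 < N x₀) {r : ℝ} (hr : 0 < r) :
    ∃ ξ, 0 < N ξ ∧ ∀ y, ‖y - ξ‖ * N ξ ≤ r → N y ≤ 2 * N ξ := by
  set R := 2 * r / N x₀
  have hR : 0 < R := by positivity
  obtain ⟨ξ, hξ, hmax⟩ := (isCompact_closedBall x₀ R).exists_isMaxOn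
    ⟨x₀, Metric.mem_closedBall_self hR.le⟩
    (f := fun y => N y * (R - ‖y - x₀‖)) (by fun_prop)
  set d := R - ‖ξ - x₀‖ with hd
  have hd0 : 0 ≤ d := by
    rw [mem_closedBall_iff_norm] at hξ
    linarith
  have h0 : 2 * r ≤ N ξ * d := by
    have := hmax (Metric.mem_closedBall_self hR.le : x₀ ∈ _)
    simp only [mem_ofPred_eq, sub_self, norm_zero, sub_zero] at this
    rwa [show N x₀ * R = 2 * r from mul_div_cancel₀ _ hx₀.ne'] at this
  have hd1 : 0 < d := hd0.lt_of_ne fun h => by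
    rw [← h] at h0
    linarith
  have hNξ : 0 < N ξ := pos_of_mul_pos_left (by linarith) hd0
  refine ⟨ξ, hNξ, fun y hy => ?_⟩
  have hyd : ‖y - ξ‖ ≤ d / 2 := by
    refine le_of_mul_le_mul_right ?_ hNξ
    linarith
  have htri : ‖y - x₀‖ ≤ ‖y - ξ‖ + ‖ξ - x₀‖ := by
    simpa using norm_add_le (y - ξ) (ξ - x₀)
  have hyR : y ∈ Metric.closedBall x₀ R := by
    rw [mem_closedBall_iff_norm]
    linarith
  have h2 : N y * (R - ‖y - x₀‖) ≤ N ξ * d := hmax hyR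
  by_contra! hlt
  have : N y * (d / 2) ≤ N y * (R - ‖y - x₀‖) :=
    mul_le_mul_of_nonneg_left (by linarith) (by linarith)
  nlinarith

/-- A nonconstant solution gives rise to a normalised one with bounded logarithmic gradient. -/
lemma IsSol.exists_bounded_gradSq_log (hn : 0 < n) {p q : ℝ} (hq : 0 ≤ q) {u : E → ℝ}
    (h : IsSol 1 p q u) {x₀ : E} (hx₀ : gradSq (fun y => log (u y)) x₀ ≠ 0) :
    ∃ v : E → ℝ, ∃ c, 0 ≤ c ∧ IsSol c p q v ∧ gradSq (fun y => log (v y)) 0 = 1 ∧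
      ∀ x, gradSq (fun y => log (v y)) x ≤ 4 := by
  set G := gradSq fun y => log (u y)
  have hG0 (x : E) : 0 ≤ G x := gradSq_nonneg _ x
  have hG : Continuous G := h.contDiff_log.gradSq.continuous
  have hdbl (k : ℕ) := exists_doubling (N := fun x => √(G x)) (by fun_prop)
    (sqrt_pos.2 ((hG0 x₀).lt_of_ne' hx₀)) (r := k + 1) (by positivity)
  choose ξ hξ hdbl using hdbl
  set s : ℕ → ℝ := fun k => (√(G (ξ k)))⁻¹
  have hs (k : ℕ) : 0 < s k := inv_pos.2 (hξ k)
  have hsG (k : ℕ) : s k ^ 2 * G (ξ k) = 1 := by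
    have := sq_sqrt (hG0 (ξ k))
    have := (hξ k).ne'
    simp only [s]
    field_simp
    linarith
  set a : ℕ → ℝ := fun k => (u (ξ k))⁻¹
  have ha (k : ℕ) : 0 < a k := inv_pos.2 (h.pos _)
  set v : ℕ → E → ℝ := fun k y => a k * u (ξ k + s k • y)
  set c : ℕ → ℝ := fun k => 1 * s k ^ (2 - q) * a k ^ (1 - p - q)
  have hc (k : ℕ) : 0 ≤ c k := by
    have := hs k
    have := ha k
    positivity
  have hv (k : ℕ) : IsSol (c k) p q (v k) := h.affine (ha k) (hs k) (ξ k)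
  have hv0 (k : ℕ) : v k 0 = 1 := by simp [v, a, (h.pos (ξ k)).ne']
  have hg0 (k : ℕ) : gradSq (fun y => log (v k y)) 0 = 1 := by
    simp only [v, h.gradSq_log_affine (ha k)]
    simpa using hsG k
  have hg (k : ℕ) (x : E) (hx : ‖x‖ ≤ k + 1) : gradSq (fun y => log (v k y)) x ≤ 4 := by
    have h1 := hdbl k (ξ k + s k • x) (by
      rw [add_sub_cancel_left, norm_smul, norm_of_nonneg (hs k).le, mul_right_comm,
        inv_mul_cancel₀ (hξ k).ne', one_mul]
      exact hx)
    have h2 : G (ξ k + s k • x) ≤ 4 * G (ξ k) := by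
      rw [← sq_sqrt (hG0 (ξ k + s k • x)), ← sq_sqrt (hG0 (ξ k))]
      nlinarith [sqrt_nonneg (G (ξ k + s k • x))]
    simp only [v, h.gradSq_log_affine (ha k)]
    have := hsG k
    have := mul_le_mul_of_nonneg_left h2 (sq_nonneg (s k))
    change s k ^ 2 * G _ ≤ 4
    linarith
  obtain ⟨C, hC⟩ := exists_source_le hn (p + q - 1) hq
  have hcC (k : ℕ) : c k ≤ C := by
    have := hC _ (c k) 0 (hv k).contDiff_log (hc k) (hv k).elaplacian_log fun y hy =>
      hg k y ((by simpa using hy : ‖y‖ ≤ 1).trans (by simp))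
    rw [hg0, hv0] at this
    simpa using this
  exact exists_limit_isSol hn hq hc hcC hv hv0 hg0 fun k x hx => hg k x (by linarith)

/-- In the superlinear range a solution with bounded logarithmic gradient can be rescaled into the
class of the weak Liouville property. -/
lemma IsSol.exists_rescaled (hn : 0 < n) {c p q : ℝ} (hq : 0 ≤ q) (hm : 0 < p + q - 1) (hc : 0 < c)
    {v : E → ℝ} (h : IsSol c p q v) (hg : ∀ x, gradSq (fun y => log (v y)) x ≤ 4) :
    ∃ a s : ℝ, 0 < a ∧ 0 < s ∧ IsSol 1 p q (fun y => a * v ((0 : E) + s • y)) ∧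
      (∀ x, gradSq (fun y => log (a * v ((0 : E) + s • y))) x ≤ 1) ∧
      ∀ x, gradSq (fun y => a * v ((0 : E) + s • y)) x ^ (q / 2) *
        (a * v ((0 : E) + s • x)) ^ (p - 1) ≤ 1 := by
  obtain ⟨C, hC⟩ := exists_source_le hn (p + q - 1) hq
  have hS (x : E) := hC _ c x h.contDiff_log hc.le h.elaplacian_log fun y _ => hg y
  set s : ℝ := (|C| + 2)⁻¹
  have hs : 0 < s := by positivity
  have hs2 : s ≤ 1 / 2 := by
    rw [one_div]
    exact inv_anti₀ two_pos (by linarith [abs_nonneg C])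
  have hsC : s ^ 2 * C ≤ 1 := by
    have h1 : s * (|C| + 2) = 1 := inv_mul_cancel₀ (by positivity)
    nlinarith [le_abs_self C, abs_nonneg C]
  set b : ℝ := c * s ^ (2 - q)
  have hb : 0 < b := by positivity
  set a : ℝ := b ^ (p + q - 1)⁻¹
  have ha : 0 < a := by positivity
  have ha1 : a ^ (p + q - 1) = b := by
    rw [← rpow_mul hb.le, inv_mul_cancel₀ hm.ne', rpow_one]
  have hcoef : c * s ^ (2 - q) * a ^ (1 - p - q) = 1 := by
    rw [show 1 - p - q = -(p + q - 1) by ring, rpow_neg ha.le, ha1]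
    exact mul_inv_cancel₀ hb.ne'
  have hsol := h.affine ha hs (0 : E)
  rw [hcoef] at hsol
  have hlog (x : E) := h.gradSq_log_affine ha s 0 x
  refine ⟨a, s, ha, hs, hsol, fun x => ?_, fun x => ?_⟩
  · rw [hlog]
    nlinarith [hg (0 + s • x), gradSq_nonneg (fun y => log (v y)) (0 + s • x)]
  · have hx := h.pos (0 + s • x)
    have hsq : (s ^ 2) ^ (q / 2) = s ^ q := by
      rw [← rpow_natCast, ← rpow_mul hs.le]
      congr 1
      push_cast
      ring
    have hss : s ^ q * s ^ (2 - q) = s ^ 2 := by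
      rw [← rpow_add hs, ← rpow_natCast]
      congr 1
      push_cast
      ring
    rw [← hsol.source_eq, hlog, mul_rpow (sq_nonneg s) (gradSq_nonneg _ _), hsq,
      log_mul ha.ne' hx.ne', mul_add, exp_add, mul_comm (p + q - 1) (log a), ← rpow_def_of_pos ha,
      ha1]
    refine le_trans ?_ hsC
    calc _ = (s ^ q * s ^ (2 - q)) * (c * (gradSq (fun y => log (v y)) (0 + s • x) ^ (q / 2) *
          exp ((p + q - 1) * log (v (0 + s • x))))) := by ring
      _ ≤ s ^ 2 * C := by
          rw [hss]
          exact mul_le_mul_of_nonneg_left (hS _) (sq_nonneg s)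

end Liouville

/-- **Corollary to Theorem 8.1.** For every `n ≥ 2`, `q ≥ 0` and `p ∈ ℝ`, the Liouville
property holds for `(p,q)` in dimension `n` if and only if the weak Liouville property
holds; that is, `𝒟_L(n) = 𝒟_WL(n)`. -/
theorem liouville_iff_weak_liouville (n : ℕ) (hn : 2 ≤ n) (p q : ℝ) (hq : 0 ≤ q) :
    (∀ u : EuclideanSpace ℝ (Fin n) → ℝ,
      ContDiff ℝ 2 u → (∀ x, 0 < u x) →
      (∀ x, elaplacian u x + ‖gradient u x‖ ^ q * u x ^ p = 0) →
      ∀ x y, u x = u y) ↔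
    (∀ u : EuclideanSpace ℝ (Fin n) → ℝ,
      ContDiff ℝ 2 u → (∀ x, 0 < u x) →
      (∀ x, elaplacian u x + ‖gradient u x‖ ^ q * u x ^ p = 0) →
      (∀ x, ‖gradient u x‖ / u x ≤ 1) →
      (∀ x, ‖gradient u x‖ ^ q * u x ^ (p - 1) ≤ 1) →
      ∀ x y, u x = u y) := by
  refine ⟨fun H u hu hpos heq _ _ => H u hu hpos heq, fun H u hu hpos heq => ?_⟩
  have hn0 : 0 < n := by lia
  have hsol : IsSol 1 p q u := isSol_one_iff.2 ⟨hu, hpos, heq⟩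
  refine hsol.eq_of_gradSq_log_eq_zero fun x₀ => ?_
  rcases le_or_gt (p + q - 1) 0 with hm | hm
  · exact gradSq_eq_zero hn0 hsol.contDiff_log zero_le_one hq hsol.elaplacian_log (Or.inr hm) x₀
  by_contra hx₀
  obtain ⟨v, c, hc, hv, hv0, hv4⟩ := hsol.exists_bounded_gradSq_log hn0 hq hx₀
  rcases hc.eq_or_lt with rfl | hc
  · have := gradSq_eq_zero hn0 hv.contDiff_log le_rfl hq hv.elaplacian_log (Or.inl rfl) 0
    linarith
  obtain ⟨a, s, ha, hs, hw, hw1, hw2⟩ := hv.exists_rescaled hn0 hq hm hc hv4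
  obtain ⟨hwC, hwpos, hweq⟩ := isSol_one_iff.1 hw
  have hconst := H _ hwC hwpos hweq (fun x => by
    rw [norm_gradient, div_le_one (hwpos x)]
    have := hw1 x
    have hx := hwpos x
    rw [hw.gradSq_log, div_le_one (by positivity), gradSq_eq] at this
    exact abs_le_of_sq_le_sq' this hx.le |>.2) fun x => by
      rw [gradSq_gradient_rpow]
      exact hw2 x
  have h0 := hv.gradSq_log_affine ha s 0 0
  rw [funext fun y => congrArg log (hconst y 0), smul_zero, add_zero, hv0, gradSq] at h0
  simp [pd] at h0
  exact (pow_pos hs 2).ne h0
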